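/- arXiv:2108.10500 — 2 statements merged into one kernel-verified Lean document; each statement's English description precedes it below -/
import Mathlib

section
/- Fix K > 0, an integer m ≥ 0, real numbers 0 < a₁, …, aₘ < 1 and 0 < k₁ < ⋯ < kₘ < K, and let Sᵢ = [aᵢ,1] × {kᵢ} ⊂ ℂ (closed horizontal slits attached to the right edge). Let D = ((0,1) × (0,K)) ∖ ⋃ᵢ Sᵢ, let B = (0,1) × {0} and T = (0,1) × {K} be the open bottom and top edges, let Γ_D = B ∪ T ∪ ⋃ᵢ Sᵢ and Γ_N = ({0} × (0,K)) ∪ ({1} × ((0,K) ∖ {k₁,…,kₘ})). Then for every w ∈ B ∪ T there exists a function P : D → ℝ such that: (i) P is harmonic and strictly positive on D; (ii) P extends continuously to cl(D) ∖ {w}; (iii) the continuous extension of P vanishes on Γ_D ∖ {w}; (iv) at every point ζ ∈ Γ_N the inner normal derivative of P exists and equals 0, i.e. lim_{ε→0⁺} (P(ζ + ε n(ζ)) − P(ζ))/ε = 0 where n(ζ) is the inner unit normal (n = 1 on the left side, n = −1 on the right side); (v) there exists r > 0 such that z ↦ P(z) − (1/π)·|Im(1/(z − w))| is bounded on D ∩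 B(w, r). -/
open Set Metric Filter Complex Topology

noncomputable section

/-- A function `f : ℂ → ℝ` is harmonic on an open set `U ⊆ ℂ ≅ ℝ²` if it is `C²` there
with vanishing Laplacian. -/
def IsHarmonicOn (f : ℂ → ℝ) (U : Set ℂ) : Prop :=
  ContDiffOn ℝ 2 f U ∧ ∀ z ∈ U,
    (iteratedFDeriv ℝ 2 f z) ![1, 1] + (iteratedFDeriv ℝ 2 f z) ![Complex.I, Complex.I] = 0

/-- The closed horizontal slit `[a,1] × {k}` in `ℂ`. -/
def slitSeg (a k : ℝ) : Set ℂ := {z | a ≤ z.re ∧ z.re ≤ 1 ∧ z.im = k}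

/-- The open unit-width rectangle of height `K` with the horizontal slits removed. -/
def slitRect (K : ℝ) (m : ℕ) (a k : Fin m → ℝ) : Set ℂ :=
  {z | 0 < z.re ∧ z.re < 1 ∧ 0 < z.im ∧ z.im < K} \ ⋃ i, slitSeg (a i) (k i)

/-- The open bottom edge `(0,1) × {0}`. -/
def botEdge : Set ℂ := {z | 0 < z.re ∧ z.re < 1 ∧ z.im = 0}

/-- The open top edge `(0,1) × {K}`. -/
def topEdge (K : ℝ) : Set ℂ := {z | 0 < z.re ∧ z.re < 1 ∧ z.im = K}

/-- Dirichlet part of the boundary: bottom edge, top edge and the slits. -/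
def gammaD (K : ℝ) (m : ℕ) (a k : Fin m → ℝ) : Set ℂ :=
  botEdge ∪ topEdge K ∪ ⋃ i, slitSeg (a i) (k i)

/-- Neumann part of the boundary: the two vertical sides (minus the slit tips on the right). -/
def gammaN (K : ℝ) (m : ℕ) (k : Fin m → ℝ) : Set ℂ :=
  {z | z.re = 0 ∧ 0 < z.im ∧ z.im < K} ∪
    {z | z.re = 1 ∧ 0 < z.im ∧ z.im < K ∧ ∀ i, z.im ≠ k i}

/-- Inner unit normal on the vertical sides: `1` on the left side, `-1` on the right side. -/
def innerNormal (ζ : ℂ) : ℂ := if ζ.re = 0 then 1 else -1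

/-- `P` (with continuous extension `H`) is a Poisson kernel of the slit rectangle with mixed
Dirichlet/Neumann boundary conditions and pole at `w`. -/
def IsMixedPoissonKernel (K : ℝ) (m : ℕ) (a k : Fin m → ℝ) (w : ℂ) (P H : ℂ → ℝ) : Prop :=
  -- (i) harmonic and strictly positive on D
  IsHarmonicOn P (slitRect K m a k) ∧
  (∀ z ∈ slitRect K m a k, 0 < P z) ∧
  -- (ii) continuous extension to cl(D) \ {w}
  ContinuousOn H (closure (slitRect K m a k) \ {w}) ∧
  (∀ z ∈ slitRect K m a k, H z = P z) ∧
  -- (iii) the extension vanishes on Γ_D \ {w}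
  (∀ z ∈ gammaD K m a k \ {w}, H z = 0) ∧
  -- (iv) vanishing inner normal derivative on Γ_N
  (∀ ζ ∈ gammaN K m k,
    Tendsto (fun ε : ℝ => (P (ζ + (ε : ℂ) * innerNormal ζ) - H ζ) / ε)
      (𝓝[>] (0 : ℝ)) (𝓝 0)) ∧
  -- (v) bounded difference with |Im 1/(z-w)|/π near w
  (∃ r > 0, ∃ C : ℝ, ∀ z ∈ slitRect K m a k ∩ ball w r,
    _root_.abs ((P z - (1 / Real.pi) * |(1 / (z - w)).im| : ℝ)) ≤ C)


open InnerProductSpace Real in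
/-- Poisson integral. -/
def PInt (f : ℂ → ℝ) (c : ℂ) (R : ℝ) (w : ℂ) : ℝ :=
  Real.circleAverage (fun z => poissonKernel c w z * f z) c R

lemma poissonKernel_contOn {c w : ℂ} {R : ℝ} (hw : w ∈ ball c R) :
    ContinuousOn (poissonKernel c w) (sphere c |R|) := by
  rw [poissonKernel_eq_re_herglotzRieszKernel]
  exact Complex.continuous_re.comp_continuousOn (continuousOn_herglotzRieszKernel_sphere hw)

lemma poissonKernel_nonneg' {c w z : ℂ} {R : ℝ} (hw : w ∈ ball c R) (hz : z ∈ sphere c |R|) :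
    0 ≤ poissonKernel c w z := by
  rw [poissonKernel_def]
  apply div_nonneg _ (by positivity)
  have h1 : ‖w - c‖ < R := by simpa [dist_eq_norm] using hw
  have h2 : ‖z - c‖ = |R| := by simpa [dist_eq_norm] using hz
  rw [h2, sq_abs]
  nlinarith [norm_nonneg (w - c)]

lemma PInt_integrable {f : ℂ → ℝ} {c w : ℂ} {R : ℝ} (hf : CircleIntegrable f c R)
    (hw : w ∈ ball c R) : CircleIntegrable (fun z => poissonKernel c w z * f z) c R := by
  have := hf.continuousOn_smul (poissonKernel_contOn hw)
  exact this

lemma PInt_mono {f g : ℂ → ℝ} {c w : ℂ} {R : ℝ} (hf : CircleIntegrable f c R)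
    (hg : CircleIntegrable g c R) (hw : w ∈ ball c R) (h : ∀ z ∈ sphere c |R|, f z ≤ g z) :
    PInt f c R w ≤ PInt g c R w := by
  apply Real.circleAverage_mono (PInt_integrable hf hw) (PInt_integrable hg hw)
  intro z hz
  exact mul_le_mul_of_nonneg_left (h z hz) (poissonKernel_nonneg' hw hz)

lemma PInt_of_harmonic {f : ℂ → ℝ} {c w : ℂ} {R : ℝ}
    (hf : InnerProductSpace.HarmonicOnNhd f (closedBall c R))
    (hw : w ∈ ball c R) : PInt f c R w = f w :=
  InnerProductSpace.HarmonicOnNhd.circleAverage_poissonKernel_smul hf hw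

lemma PInt_harmonic {f : ℂ → ℝ} {c : ℂ} {R : ℝ} (hf : CircleIntegrable f c R) :
    InnerProductSpace.HarmonicOnNhd (PInt f c R) (ball c R) := by
  intro w hw
  have hf0 : CircleIntegrable (fun z => f (z + c)) 0 R := by
    have : (fun θ => f (circleMap c R θ)) = fun θ => f (circleMap 0 R θ + c) := by
      ext θ; simp [circleMap, add_comm]
    unfold CircleIntegrable at hf ⊢
    rw [this] at hf
    exact hf
  have hfc : CircleIntegrable (fun z => ((f (z + c) : ℝ) : ℂ)) 0 R := by
    simp only [CircleIntegrable, intervalIntegrable_iff] at hf0 ⊢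
    exact Complex.ofRealCLM.integrable_comp hf0
  have han := analyticOnNhd_circleAverage_herglotzRieszKernel_smul hfc
  have hw0 : w - c ∈ ball (0 : ℂ) R := by simpa [dist_eq_norm] using hw
  have h1 : AnalyticAt ℂ (fun w : ℂ => Real.circleAverage
      (fun ζ ↦ herglotzRieszKernel 0 (w - c) ζ • ((f (ζ + c) : ℝ) : ℂ)) 0 R) w := by
    have h2 : AnalyticAt ℂ (fun w : ℂ => w - c) w := by fun_prop
    exact (han (w - c) hw0).comp_of_eq h2 rfl
  refine (InnerProductSpace.harmonicAt_congr_nhds ?_).1 h1.harmonicAt_re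
  filter_upwards [isOpen_ball.mem_nhds hw] with x hx
  have hx0 : x - c ∈ ball (0 : ℂ) R := by simpa [dist_eq_norm] using hx
  have := re_circleAverage_herglotzRieszKernel_smul hf0 hx0
  refine this.trans ?_
  unfold PInt
  rw [← Real.circleAverage_map_add_const (c := c) (f := fun z => poissonKernel c x z * f z),
    poissonKernel_eq_re_herglotzRieszKernel]
  congr 1
  ext z
  simp [herglotzRieszKernel_add_const]

/-- Poisson modification. -/
def pmod (v : ℂ → ℝ) (c : ℂ) (R : ℝ) (z : ℂ) : ℝ :=
  open Classical in if z ∈ ball c R then PInt v c R z else v z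

lemma pmod_in {v : ℂ → ℝ} {c : ℂ} {R : ℝ} {z : ℂ} (hz : z ∈ ball c R) :
    pmod v c R z = PInt v c R z := by simp only [pmod, hz, if_true]

lemma pmod_out {v : ℂ → ℝ} {c : ℂ} {R : ℝ} {z : ℂ} (hz : z ∉ ball c R) :
    pmod v c R z = v z := by simp only [pmod, hz, if_false]

/-- The harmonic function agreeing with `|z - ζ|²` on the circle. -/
lemma sq_harm (c ζ : ℂ) (R A B : ℝ) (s : Set ℂ) :
    InnerProductSpace.HarmonicOnNhd
      (fun z : ℂ => A + B * (2 * R ^ 2 - 2 * ((z - c) * (starRingEnd ℂ) (ζ - c)).re)) s := by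
  intro w _
  have h : AnalyticAt ℂ (fun z : ℂ => (A : ℂ) + B * (2 * R ^ 2 - 2 *
      ((z - c) * (starRingEnd ℂ) (ζ - c)))) w := by fun_prop
  convert h.harmonicAt_re using 2 with z
  simp [← ofReal_pow]

lemma pmod_boundary {v : ℂ → ℝ} {c ζ : ℂ} {R : ℝ} (hR : 0 < R)
    (hv : ContinuousOn v (sphere c R)) (hζ : ζ ∈ sphere c R) :
    Tendsto (PInt v c R) (𝓝[ball c R] ζ) (𝓝 (v ζ)) := by
  have hcint : CircleIntegrable v c R := hv.circleIntegrable hR.le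
  obtain ⟨M, hM⟩ := (isCompact_sphere c R).exists_bound_of_continuousOn hv
  have hM0 : 0 ≤ M := (norm_nonneg _).trans (hM ζ hζ)
  rw [Metric.tendsto_nhds]
  intro ε hε
  have hvζ := hv ζ hζ
  rw [Metric.continuousWithinAt_iff] at hvζ
  obtain ⟨δ, hδ, hd⟩ := hvζ (ε / 2) (by positivity)
  set B : ℝ := 2 * M / δ ^ 2 with hB
  have hB0 : 0 ≤ B := by positivity
  let q : ℂ → ℝ := fun z => 2 * R ^ 2 - 2 * ((z - c) * (starRingEnd ℂ) (ζ - c)).re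
  have hζR : ‖ζ - c‖ = R := by simpa [dist_eq_norm] using hζ
  have hq : ∀ z ∈ sphere c R, q z = ‖z - ζ‖ ^ 2 := by
    intro z hz
    have hzR : ‖z - c‖ = R := by simpa [dist_eq_norm] using hz
    have : z - ζ = (z - c) - (ζ - c) := by ring
    rw [this, ← Complex.normSq_eq_norm_sq, Complex.normSq_sub, Complex.normSq_eq_norm_sq,
      Complex.normSq_eq_norm_sq, hzR, hζR]
    simp only [q]; ring
  have hq0 : Tendsto (fun z => ε / 2 + B * q z) (𝓝[ball c R] ζ) (𝓝 (ε / 2)) := by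
    have hc : Continuous (fun z => ε / 2 + B * q z) := by
      simp only [q]; fun_prop
    have h1 := (hc.tendsto ζ).mono_left (nhdsWithin_le_nhds (s := ball c R))
    rw [hq ζ hζ] at h1
    simpa using h1
  have hbd : ∀ z ∈ sphere c R, |v z - v ζ| ≤ ε / 2 + B * q z := by
    intro z hz
    rw [hq z hz]
    by_cases h : dist z ζ < δ
    · have := hd hz h
      rw [Real.dist_eq] at this
      have h3 : 0 ≤ B * ‖z - ζ‖ ^ 2 := by positivity
      linarith
    · rw [dist_eq_norm, not_lt] at h
      have h1 : |v z - v ζ| ≤ 2 * M := by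
        have h1 := hM z hz
        have h2 := hM ζ hζ
        rw [Real.norm_eq_abs] at h1 h2
        calc |v z - v ζ| ≤ |v z| + |v ζ| := abs_sub _ _
          _ ≤ _ := by linarith
      have h2 : 2 * M ≤ B * ‖z - ζ‖ ^ 2 := by
        rw [hB, div_mul_eq_mul_div, le_div_iff₀ (by positivity)]
        gcongr
      linarith
  have habs : |R| = R := abs_of_pos hR
  filter_upwards [hq0.eventually (gt_mem_nhds (by linarith : ε / 2 < ε)), self_mem_nhdsWithin]
    with z hz hzb
  have hU := sq_harm c ζ R (v ζ + ε / 2) B (closedBall c R)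
  have hL := sq_harm c ζ R (v ζ - ε / 2) (-B) (closedBall c R)
  have ciU := (hU.continuousOn.mono sphere_subset_closedBall).circleIntegrable hR.le
  have ciL := (hL.continuousOn.mono sphere_subset_closedBall).circleIntegrable hR.le
  have h1 := PInt_mono hcint ciU hzb (by
    intro x hx
    rw [habs] at hx
    have := abs_le.1 (hbd x hx)
    simp only [q] at this
    linarith [this.2])
  have h2 := PInt_mono ciL hcint hzb (by
    intro x hx
    rw [habs] at hx
    have := abs_le.1 (hbd x hx)
    simp only [q] at this
    linarith [this.1])
  rw [PInt_of_harmonic hU hzb] at h1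
  rw [PInt_of_harmonic hL hzb] at h2
  simp only [q] at hz
  rw [Real.dist_eq, abs_lt]
  constructor <;> linarith

lemma pmod_continuousOn {v : ℂ → ℝ} {c : ℂ} {R : ℝ} {Ω : Set ℂ} (hR : 0 < R)
    (hv : ContinuousOn v Ω) (hB : closedBall c R ⊆ Ω) : ContinuousOn (pmod v c R) Ω := by
  have hs : ContinuousOn v (sphere c R) := hv.mono (sphere_subset_closedBall.trans hB)
  have hcint : CircleIntegrable v c R := hs.circleIntegrable hR.le
  intro z hz
  rcases lt_trichotomy (dist z c) R with h | h | h
  · have hzb : z ∈ ball c R := h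
    have h1 := (PInt_harmonic hcint).continuousOn.continuousAt (isOpen_ball.mem_nhds hzb)
    refine (h1.congr ?_).continuousWithinAt
    filter_upwards [isOpen_ball.mem_nhds hzb] with x hx
    rw [pmod_in hx]
  · have hzs : z ∈ sphere c R := h
    have hzb : z ∉ ball c R := by simp [h]
    unfold ContinuousWithinAt
    rw [pmod_out hzb]
    have h1 := pmod_boundary hR hs hzs
    have h2 : Tendsto v (𝓝[Ω] z) (𝓝 (v z)) := hv z hz
    rw [Metric.tendsto_nhds] at h1 h2 ⊢
    intro ε hε
    have h3 := h1 ε hε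
    have h4 := h2 ε hε
    rw [eventually_nhdsWithin_iff] at h3 h4 ⊢
    filter_upwards [h3, h4] with x hx3 hx4 hxΩ
    by_cases hx : x ∈ ball c R
    · rw [pmod_in hx]; exact hx3 hx
    · rw [pmod_out hx]; exact hx4 hxΩ
  · have h1 : ∀ᶠ x in 𝓝[Ω] z, x ∉ closedBall c R := by
      apply mem_nhdsWithin_of_mem_nhds
      exact isClosed_closedBall.isOpen_compl.mem_nhds (by simpa using h)
    refine (hv z hz).congr_of_eventuallyEq ?_ (pmod_out (by simpa using h.le))
    filter_upwards [h1] with x hx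
    exact pmod_out (fun h => hx (ball_subset_closedBall h))

/-- local sub-mean value property at a point -/
def SubAt (v : ℂ → ℝ) (z : ℂ) : Prop := ∀ᶠ r in 𝓝[>] (0 : ℝ), v z ≤ Real.circleAverage v z r

lemma small_disk {U : Set ℂ} {z : ℂ} (hU : U ∈ 𝓝 z) :
    ∀ᶠ r in 𝓝[>] (0 : ℝ), 0 < r ∧ closedBall z r ⊆ U := by
  obtain ⟨ε, hε, h⟩ := Metric.mem_nhds_iff.1 hU
  filter_upwards [Ioo_mem_nhdsGT hε] with r hr
  exact ⟨hr.1, (closedBall_subset_ball hr.2).trans h⟩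

lemma sphere_sub {z : ℂ} {r : ℝ} {U : Set ℂ} (hr : 0 < r) (h : closedBall z r ⊆ U) :
    sphere z |r| ⊆ U := by
  rw [abs_of_pos hr]; exact sphere_subset_closedBall.trans h

lemma ci_of {v : ℂ → ℝ} {z : ℂ} {r : ℝ} {U : Set ℂ} (hv : ContinuousOn v U) (hr : 0 < r)
    (h : closedBall z r ⊆ U) : CircleIntegrable v z r :=
  (hv.mono (sphere_subset_closedBall.trans h)).circleIntegrable hr.le

lemma SubAt.congr {u v : ℂ → ℝ} {z : ℂ} (h : SubAt u z) (huv : u =ᶠ[𝓝 z] v) : SubAt v z := by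
  filter_upwards [h, small_disk huv] with r h1 h2
  rw [← huv.self_of_nhds]
  refine h1.trans (le_of_eq ?_)
  apply Real.circleAverage_congr_sphere
  intro x hx
  exact sphere_sub h2.1 h2.2 hx

/-- continuous and locally subharmonic -/
structure LSub (v : ℂ → ℝ) (U : Set ℂ) : Prop where
  cont : ContinuousOn v U
  sub : ∀ z ∈ U, SubAt v z

lemma harm_subAt {f : ℂ → ℝ} {z : ℂ} (h : InnerProductSpace.HarmonicAt f z) : SubAt f z := by
  filter_upwards [small_disk h.eventually] with r hr
  have := InnerProductSpace.HarmonicOnNhd.circleAverage_eq (f := f) (c := z) (R := r)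
    (by rw [abs_of_pos hr.1]; exact fun x hx => hr.2 hx)
  rw [this]

lemma LSub.of_harm {f : ℂ → ℝ} {U : Set ℂ} (h : InnerProductSpace.HarmonicOnNhd f U) :
    LSub f U := ⟨h.continuousOn, fun z hz => harm_subAt (h z hz)⟩

lemma LSub.mono {f : ℂ → ℝ} {U V : Set ℂ} (h : LSub f U) (hV : V ⊆ U) :
    LSub f V := ⟨h.cont.mono hV, fun z hz => h.sub z (hV hz)⟩

lemma LSub.of_neg_harm {f : ℂ → ℝ} {U : Set ℂ} (h : InnerProductSpace.HarmonicOnNhd f U) :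
    LSub (fun z => - f z) U := LSub.of_harm (f := fun z => - f z) h.neg

lemma LSub.sup {u v : ℂ → ℝ} {U : Set ℂ} (hU : IsOpen U) (hu : LSub u U) (hv : LSub v U) :
    LSub (fun z => max (u z) (v z)) U := by
  have hc : ContinuousOn (fun z => max (u z) (v z)) U := hu.cont.sup hv.cont
  refine ⟨hc, fun z hz => ?_⟩
  filter_upwards [hu.sub z hz, hv.sub z hz, small_disk (hU.mem_nhds hz)] with r h1 h2 h3
  apply max_le
  · exact h1.trans (Real.circleAverage_mono (ci_of hu.cont h3.1 h3.2) (ci_of hc h3.1 h3.2)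
      (fun x _ => le_max_left _ _))
  · exact h2.trans (Real.circleAverage_mono (ci_of hv.cont h3.1 h3.2) (ci_of hc h3.1 h3.2)
      (fun x _ => le_max_right _ _))

lemma LSub.const_mul {u : ℂ → ℝ} {U : Set ℂ} (hu : LSub u U) {M : ℝ} (hM : 0 ≤ M) :
    LSub (fun z => M * u z) U := by
  refine ⟨continuousOn_const.mul hu.cont, fun z hz => ?_⟩
  filter_upwards [hu.sub z hz] with r h1
  have := Real.circleAverage_fun_smul (a := M) (f := u) (c := z) (R := r)
  simp only [smul_eq_mul] at this
  rw [this]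
  exact mul_le_mul_of_nonneg_left h1 hM

lemma circleAverage_normSq (c : ℂ) (r : ℝ) :
    Real.circleAverage (fun z : ℂ => ‖z‖ ^ 2) c r = ‖c‖ ^ 2 + r ^ 2 := by
  have h1 : ∀ z ∈ sphere c |r|, ‖z‖ ^ 2 =
      ((‖c‖ ^ 2 + r ^ 2 : ℝ) + 2 * ((z - c) * (starRingEnd ℂ) c)).re := by
    intro z hz
    have hz' : ‖z - c‖ = |r| := by simpa [dist_eq_norm] using hz
    have h2 : z = (z - c) + c := by ring
    rw [← Complex.normSq_eq_norm_sq, h2, Complex.normSq_add, Complex.normSq_eq_norm_sq,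
      Complex.normSq_eq_norm_sq, hz', sq_abs]
    simp [← ofReal_pow]
    ring
  rw [Real.circleAverage_congr_sphere (f₂ := fun z =>
    ((‖c‖ ^ 2 + r ^ 2 : ℝ) + 2 * ((z - c) * (starRingEnd ℂ) c)).re) h1]
  have := InnerProductSpace.HarmonicOnNhd.circleAverage_eq (f := fun z =>
    ((‖c‖ ^ 2 + r ^ 2 : ℝ) + 2 * ((z - c) * (starRingEnd ℂ) c)).re) (c := c) (R := r) (by
      intro w _
      have h : AnalyticAt ℂ (fun z : ℂ => (((‖c‖ ^ 2 + r ^ 2 : ℝ) : ℂ) + 2 *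
        ((z - c) * (starRingEnd ℂ) c))) w := by fun_prop
      exact h.harmonicAt_re)
  rw [this]
  simp [← ofReal_pow]

/-- Maximum principle on a disk. -/
lemma max_principle {v h : ℂ → ℝ} {c : ℂ} {R : ℝ}
    (hvc : ContinuousOn v (closedBall c R)) (hv : ∀ z ∈ ball c R, SubAt v z)
    (hh : InnerProductSpace.HarmonicOnNhd h (ball c R)) (hhc : ContinuousOn h (closedBall c R))
    (hs : ∀ z ∈ sphere c R, v z ≤ h z) : ∀ z ∈ ball c R, v z ≤ h z := by
  have key : ∀ ε > 0, ∀ z ∈ ball c R, v z - h z ≤ ε * (‖c‖ + |R|) ^ 2 := by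
    intro ε hε z hz
    let u : ℂ → ℝ := fun z => v z - h z + ε * ‖z‖ ^ 2
    have huc : ContinuousOn u (closedBall c R) := by
      apply (hvc.sub hhc).add
      fun_prop
    obtain ⟨x, hx, hmax⟩ := (isCompact_closedBall c R).exists_isMaxOn ⟨z, ball_subset_closedBall hz⟩ huc
    have hxs : x ∈ sphere c R := by
      by_contra hns
      have hxb : x ∈ ball c R := by
        rcases lt_or_eq_of_le (mem_closedBall.1 hx) with h | h
        · exact h
        · exact absurd h hns
      have hnb := isOpen_ball.mem_nhds hxb
      obtain ⟨r, ⟨h1, h2⟩, h3⟩ := ((small_disk hnb).and (hv x hxb)).exists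
      have h4 := InnerProductSpace.HarmonicOnNhd.circleAverage_eq (f := h) (c := x) (R := r)
        (by rw [abs_of_pos h1]; exact fun y hy => hh y (h2 hy))
      have i1 := ci_of (hvc.mono ball_subset_closedBall) h1 h2
      have i2 := ci_of (hhc.mono ball_subset_closedBall) h1 h2
      have i3 := ci_of (huc.mono ball_subset_closedBall) h1 h2
      have i4 : CircleIntegrable (fun z : ℂ => ε * ‖z‖ ^ 2) x r :=
        ContinuousOn.circleIntegrable h1.le (by fun_prop)
      have e1 : Real.circleAverage u x r = Real.circleAverage v x r - h x
          + ε * (‖x‖ ^ 2 + r ^ 2) := by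
        have e2 := Real.circleAverage_fun_add (i1.sub i2) i4
        have e3 := Real.circleAverage_sub i1 i2
        have e4 := Real.circleAverage_fun_smul (a := ε) (f := fun z : ℂ => ‖z‖ ^ 2) (c := x) (R := r)
        simp only [smul_eq_mul] at e4
        rw [circleAverage_normSq] at e4
        rw [e3, e4, h4] at e2
        exact e2
      have e5 : Real.circleAverage u x r ≤ u x :=
        Real.circleAverage_mono_on_of_le_circle i3 (fun y hy =>
          hmax (ball_subset_closedBall (sphere_sub h1 h2 hy)))
      rw [e1] at e5
      simp only [u] at e5
      have : 0 < ε * r ^ 2 := by positivity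
      linarith
    have h1 : u z ≤ u x := hmax (ball_subset_closedBall hz)
    have h2 := hs x hxs
    have h3 : ‖x‖ ≤ ‖c‖ + |R| := by
      have : x = c + (x - c) := by ring
      rw [this]
      refine (norm_add_le _ _).trans ?_
      have : ‖x - c‖ = R := by simpa [dist_eq_norm] using hxs
      rw [this]; gcongr; exact le_abs_self R
    have h4 : ε * ‖x‖ ^ 2 ≤ ε * (‖c‖ + |R|) ^ 2 := by gcongr
    have h5 : 0 ≤ ε * ‖z‖ ^ 2 := by positivity
    simp only [u] at h1
    linarith
  intro z hz
  by_contra hlt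
  push Not at hlt
  set T := (‖c‖ + |R|) ^ 2 with hT
  have hT0 : 0 ≤ T := by positivity
  have h1 := key ((v z - h z) / (2 * (T + 1))) (by apply div_pos <;> linarith) z hz
  rw [div_mul_eq_mul_div, le_div_iff₀ (by linarith)] at h1
  nlinarith

lemma LSub.le_pmod {v : ℂ → ℝ} {U : Set ℂ} {c : ℂ} {R : ℝ} (hv : LSub v U) (hR : 0 < R)
    (hB : closedBall c R ⊆ U) (z : ℂ) : v z ≤ pmod v c R z := by
  have hcint := ci_of hv.cont hR hB
  by_cases hz : z ∈ ball c R
  · apply max_principle (hv.cont.mono hB) (fun z hz => hv.sub z (hB (ball_subset_closedBall hz)))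
      (h := pmod v c R) _ ((pmod_continuousOn hR hv.cont hB).mono hB) _ z hz
    · intro x hx
      refine (InnerProductSpace.harmonicAt_congr_nhds ?_).1 (PInt_harmonic hcint x hx)
      filter_upwards [isOpen_ball.mem_nhds hx] with y hy
      rw [pmod_in hy]
    · intro x hx
      rw [pmod_out (by rw [mem_sphere] at hx; simp [hx])]
  · rw [pmod_out hz]

lemma pmod_le {v v0 : ℂ → ℝ} {U : Set ℂ} {c : ℂ} {R : ℝ} (hv : ContinuousOn v U)
    (hv0 : LSub (fun z => - v0 z) U) (hle : ∀ z ∈ U, v z ≤ v0 z) (hR : 0 < R)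
    (hB : closedBall c R ⊆ U) : ∀ z ∈ U, pmod v c R z ≤ v0 z := by
  intro z hzU
  have hcint := ci_of hv hR hB
  by_cases hz : z ∈ ball c R
  · have hc := (pmod_continuousOn hR hv hB).mono hB
    have := max_principle (h := fun z => - pmod v c R z) (hv0.cont.mono hB)
      (fun z hz => hv0.sub z (hB (ball_subset_closedBall hz)))
      (by
        intro x hx
        refine (InnerProductSpace.harmonicAt_congr_nhds ?_).1 (PInt_harmonic hcint x hx).neg
        filter_upwards [isOpen_ball.mem_nhds hx] with y hy
        rw [pmod_in hy]; rfl) hc.neg (by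
        intro x hx
        rw [pmod_out (by rw [mem_sphere] at hx; simp [hx])]
        exact neg_le_neg (hle x (hB (sphere_subset_closedBall hx)))) z hz
    linarith
  · rw [pmod_out hz]; exact hle z hzU

lemma LSub.pmod {v : ℂ → ℝ} {U : Set ℂ} {c : ℂ} {R : ℝ} (hU : IsOpen U) (hv : LSub v U)
    (hR : 0 < R) (hB : closedBall c R ⊆ U) : LSub (pmod v c R) U := by
  have hcint := ci_of hv.cont hR hB
  have hc := pmod_continuousOn hR hv.cont hB
  refine ⟨hc, fun z hz => ?_⟩
  by_cases hzb : z ∈ ball c R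
  · refine (harm_subAt (PInt_harmonic hcint z hzb)).congr ?_
    filter_upwards [isOpen_ball.mem_nhds hzb] with y hy
    rw [pmod_in hy]
  · filter_upwards [hv.sub z hz, small_disk (hU.mem_nhds hz)] with r h1 h2
    rw [pmod_out hzb]
    exact h1.trans (Real.circleAverage_mono (ci_of hv.cont h2.1 h2.2) (ci_of hc h2.1 h2.2)
      (fun x _ => hv.le_pmod hR hB x))

/-- circle averages are invariant under orientation reversing isometries -/
lemma circleAverage_refl (f : ℂ → ℝ) (α : ℂ) (φ : ℝ) (c : ℂ) (R : ℝ) :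
    Real.circleAverage (fun z => f (α + cexp (φ * I) * (starRingEnd ℂ) z)) c R =
      Real.circleAverage f (α + cexp (φ * I) * (starRingEnd ℂ) c) R := by
  have h1 : ∀ θ : ℝ, α + cexp (φ * I) * (starRingEnd ℂ) (circleMap c R θ) =
      circleMap (α + cexp (φ * I) * (starRingEnd ℂ) c) R (φ - θ) := by
    intro θ
    simp only [circleMap, map_add, map_mul, conj_ofReal, ← Complex.exp_conj, conj_I]
    push_cast
    rw [sub_mul, sub_eq_add_neg, Complex.exp_add]
    ring_nf
  simp only [Real.circleAverage_def, h1]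
  congr 1
  rw [intervalIntegral.integral_comp_sub_left
    (fun θ => f (circleMap (α + cexp (φ * I) * (starRingEnd ℂ) c) R θ)) φ]
  have hp : Function.Periodic
      (fun θ => f (circleMap (α + cexp (φ * I) * (starRingEnd ℂ) c) R θ)) (2 * Real.pi) :=
    (periodic_circleMap _ _).comp f
  have := hp.intervalIntegral_add_eq (φ - 2 * Real.pi) 0
  simpa using this

lemma LSub.refl {v : ℂ → ℝ} {U V : Set ℂ} (hv : LSub v U) (α : ℂ) (φ : ℝ)
    (hUV : ∀ z ∈ V, α + cexp (φ * I) * (starRingEnd ℂ) z ∈ U) :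
    LSub (fun z => v (α + cexp (φ * I) * (starRingEnd ℂ) z)) V := by
  refine ⟨hv.cont.comp (by fun_prop) hUV, fun z hz => ?_⟩
  filter_upwards [hv.sub _ (hUV z hz)] with r hr
  rw [circleAverage_refl]
  exact hr

lemma harnack {P : ℂ → ℝ} {z x : ℂ} {R : ℝ}
    (hP : InnerProductSpace.HarmonicOnNhd P (closedBall z R))
    (h0 : ∀ y ∈ closedBall z R, 0 ≤ P y) (hx : x ∈ ball z R) (hz : P z = 0) : P x = 0 := by
  have hR : 0 < R := pos_of_mem_ball hx
  refine le_antisymm ?_ (h0 x (ball_subset_closedBall hx))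
  have hcint := ci_of hP.continuousOn hR subset_rfl
  rw [← PInt_of_harmonic hP hx]
  set C := (R + ‖x - z‖) / (R - ‖x - z‖)
  have h1 : PInt P z R x ≤ Real.circleAverage (fun y => C * P y) z R := by
    apply Real.circleAverage_mono (PInt_integrable hcint hx)
    · exact (continuousOn_const.mul (hP.continuousOn.mono sphere_subset_closedBall)).circleIntegrable hR.le
    · intro y hy
      rw [abs_of_pos hR] at hy
      apply mul_le_mul_of_nonneg_right _ (h0 y (sphere_subset_closedBall hy))
      rw [poissonKernel_eq_re_herglotzRieszKernel]
      exact re_herglotzRieszKernel_le hy hx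
  have h2 := Real.circleAverage_fun_smul (a := C) (f := P) (c := z) (R := R)
  simp only [smul_eq_mul] at h2
  rw [h2, InnerProductSpace.HarmonicOnNhd.circleAverage_eq (by rwa [abs_of_pos hR]), hz] at h1
  simpa using h1

lemma strong_min {P : ℂ → ℝ} {U : Set ℂ} (hU : IsOpen U) (hc : IsPreconnected U)
    (hP : InnerProductSpace.HarmonicOnNhd P U) (h0 : ∀ y ∈ U, 0 ≤ P y) {z1 : ℂ} (hz1 : z1 ∈ U)
    (hp : 0 < P z1) : ∀ z ∈ U, 0 < P z := by
  by_contra hcon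
  push Not at hcon
  obtain ⟨z, hz, hz0⟩ := hcon
  have hz0 : P z = 0 := le_antisymm hz0 (h0 z hz)
  have oA : IsOpen (U ∩ P ⁻¹' Ioi 0) := hP.continuousOn.isOpen_inter_preimage hU isOpen_Ioi
  have oB : IsOpen (U ∩ P ⁻¹' {0}) := by
    rw [isOpen_iff_mem_nhds]
    rintro y ⟨hy, hy0⟩
    obtain ⟨r, hr, hs⟩ := (small_disk (hU.mem_nhds hy)).exists
    filter_upwards [ball_mem_nhds y hr] with x hx
    exact ⟨hs (ball_subset_closedBall hx), harnack (hP.mono hs) (fun w hw => h0 w (hs hw)) hx hy0⟩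
  obtain ⟨x, _, h1, h2⟩ := hc _ _ oA oB (by
    intro y hy
    rcases (h0 y hy).lt_or_eq with h | h
    · exact Or.inl ⟨hy, h⟩
    · exact Or.inr ⟨hy, h.symm⟩) ⟨z1, hz1, hz1, hp⟩ ⟨z, hz, hz, hz0⟩
  have a := h1.2
  have b := h2.2
  simp only [mem_preimage, mem_Ioi, mem_singleton_iff] at a b
  linarith

/-- Perron family -/
def PFam (v0 : ℂ → ℝ) (U : Set ℂ) : Set (ℂ → ℝ) := {v | LSub v U ∧ ∀ z ∈ U, v z ≤ v0 z}

/-- Perron function -/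
def perronFn (v0 : ℂ → ℝ) (U : Set ℂ) (z : ℂ) : ℝ := sSup ((fun v : ℂ → ℝ => v z) '' PFam v0 U)

lemma PFam.le_perron {v0 v : ℂ → ℝ} {U : Set ℂ} (hv : v ∈ PFam v0 U) {z : ℂ} (hz : z ∈ U) :
    v z ≤ perronFn v0 U z := by
  apply le_csSup
  · refine ⟨v0 z, ?_⟩
    rintro _ ⟨u, hu, rfl⟩
    exact hu.2 z hz
  · exact ⟨v, hv, rfl⟩

lemma perron_le {v0 : ℂ → ℝ} {U : Set ℂ} (hne : (PFam v0 U).Nonempty) {z : ℂ} {b : ℝ}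
    (h : ∀ v ∈ PFam v0 U, v z ≤ b) : perronFn v0 U z ≤ b := by
  apply csSup_le (hne.image _)
  rintro _ ⟨u, hu, rfl⟩
  exact h u hu

lemma PFam.sup {v0 u v : ℂ → ℝ} {U : Set ℂ} (hU : IsOpen U) (hu : u ∈ PFam v0 U)
    (hv : v ∈ PFam v0 U) : u ⊔ v ∈ PFam v0 U :=
  ⟨hu.1.sup hU hv.1, fun z hz => max_le (hu.2 z hz) (hv.2 z hz)⟩

lemma PFam.partialSups {v0 : ℂ → ℝ} {U : Set ℂ} (hU : IsOpen U) {f : ℕ → ℂ → ℝ}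
    (hf : ∀ n, f n ∈ PFam v0 U) (n : ℕ) : partialSups f n ∈ PFam v0 U := by
  induction n with
  | zero => simpa using hf 0
  | succ n ih => rw [partialSups_add_one]; exact PFam.sup hU ih (hf _)

lemma perron_harmonic {v0 : ℂ → ℝ} {U : Set ℂ} (hU : IsOpen U) (hv0 : LSub (fun z => - v0 z) U)
    (hne : (PFam v0 U).Nonempty) : InnerProductSpace.HarmonicOnNhd (perronFn v0 U) U := by
  intro z0 hz0
  obtain ⟨R, hR, hB⟩ := (small_disk (hU.mem_nhds hz0)).exists
  set P := perronFn v0 U with hP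
  let d := TopologicalSpace.denseSeq ℂ
  have hex : ∀ n : ℕ, ∃ v ∈ PFam v0 U,
      P (d n.unpair.1) - 1 / ((n.unpair.2 : ℝ) + 1) < v (d n.unpair.1) := by
    intro n
    have := exists_lt_of_lt_csSup (hne.image (fun v : ℂ → ℝ => v (d n.unpair.1)))
      (b := P (d n.unpair.1) - 1 / ((n.unpair.2 : ℝ) + 1))
      (by
        have : 0 < 1 / ((n.unpair.2 : ℝ) + 1) := by positivity
        change _ < P (d n.unpair.1)
        linarith)
    obtain ⟨_, ⟨v, hv, rfl⟩, h⟩ := this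
    exact ⟨v, hv, h⟩
  choose f hf hfd using hex
  let V : ℕ → ℂ → ℝ := fun n => partialSups f n
  have hV : ∀ n, V n ∈ PFam v0 U := PFam.partialSups hU hf
  have hVmono : Monotone V := (partialSups f).monotone
  have hfV : ∀ n, f n ≤ V n := fun n => le_partialSups f n
  let VV : ℂ → ℝ := fun z => ⨆ n, V n z
  have hVlim : ∀ z ∈ U, Tendsto (fun n => V n z) atTop (𝓝 (VV z)) := by
    intro z hz
    apply tendsto_atTop_ciSup (fun a b h => hVmono h z)
    refine ⟨v0 z, ?_⟩
    rintro _ ⟨n, rfl⟩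
    exact (hV n).2 z hz
  have hsU : sphere z0 R ⊆ U := sphere_subset_closedBall.trans hB
  have hv0c : ContinuousOn v0 U := by simpa only [neg_neg] using hv0.cont.fun_neg
  obtain ⟨M1, hM1⟩ := (isCompact_sphere z0 R).exists_bound_of_continuousOn (hv0c.mono hsU)
  obtain ⟨M2, hM2⟩ := (isCompact_sphere z0 R).exists_bound_of_continuousOn ((hV 0).1.cont.mono hsU)
  have hbd : ∀ n, ∀ z ∈ sphere z0 R, |V n z| ≤ M1 + M2 := by
    intro n z hz
    have a1 := abs_le.1 (hM1 z hz)
    have a2 := abs_le.1 (hM2 z hz)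
    have a3 := (hV n).2 z (hsU hz)
    have a4 := hVmono (Nat.zero_le n) z
    have b1 := (abs_nonneg _).trans (hM1 z hz)
    have b2 := (abs_nonneg _).trans (hM2 z hz)
    rw [abs_le]
    constructor <;> linarith
  have hcm : ∀ θ, circleMap z0 R θ ∈ sphere z0 R := fun θ => circleMap_mem_sphere _ hR.le θ
  have hVc : ∀ n, Continuous (fun θ => V n (circleMap z0 R θ)) := fun n =>
    ((hV n).1.cont.mono hsU).comp_continuous (continuous_circleMap z0 R) hcm
  have hmeas : Measurable (fun θ => VV (circleMap z0 R θ)) := by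
    refine measurable_of_tendsto_metrizable (fun n => (hVc n).measurable) ?_
    rw [tendsto_pi_nhds]
    intro θ
    exact hVlim _ (hsU (hcm θ))
  have hVVbd : ∀ z ∈ sphere z0 R, |VV z| ≤ M1 + M2 := by
    intro z hz
    exact le_of_tendsto (hVlim z (hsU hz)).abs (Eventually.of_forall fun n => hbd n z hz)
  have hVVint : CircleIntegrable VV z0 R := by
    unfold CircleIntegrable
    refine (intervalIntegrable_const (c := M1 + M2)).mono_fun hmeas.aestronglyMeasurable ?_
    refine Eventually.of_forall fun θ => ?_
    exact (hVVbd _ (hcm θ)).trans (le_abs_self _)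
  have hVint : ∀ n, CircleIntegrable (V n) z0 R := fun n => ci_of (hV n).1.cont hR hB
  have hlim : ∀ w ∈ ball z0 R, Tendsto (fun n => PInt (V n) z0 R w) atTop (𝓝 (PInt VV z0 R w)) := by
    intro w hw
    unfold PInt
    simp only [Real.circleAverage_def]
    apply Tendsto.const_smul
    have hkc : Continuous (fun θ => poissonKernel z0 w (circleMap z0 R θ)) :=
      (poissonKernel_contOn hw).comp_continuous (continuous_circleMap z0 R)
        (fun θ => by rw [abs_of_pos hR]; exact hcm θ)
    apply intervalIntegral.tendsto_integral_filter_of_dominated_convergence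
      (fun θ => poissonKernel z0 w (circleMap z0 R θ) * (M1 + M2))
    · exact Eventually.of_forall fun n => (hkc.mul (hVc n)).aestronglyMeasurable
    · refine Eventually.of_forall fun n => Eventually.of_forall fun θ _ => ?_
      have := poissonKernel_nonneg' hw (by rw [abs_of_pos hR]; exact hcm θ)
      rw [norm_mul, Real.norm_of_nonneg this]
      exact mul_le_mul_of_nonneg_left (hbd n _ (hcm θ)) this
    · exact (hkc.mul continuous_const).intervalIntegrable _ _
    · refine Eventually.of_forall fun θ _ => ?_
      exact (hVlim _ (hsU (hcm θ))).const_mul _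
  have hW := PInt_harmonic hVVint
  have hWP : ∀ w ∈ ball z0 R, PInt VV z0 R w ≤ P w := by
    intro w hw
    apply le_of_tendsto (hlim w hw) (Eventually.of_forall fun n => ?_)
    have h1 : pmod (V n) z0 R ∈ PFam v0 U :=
      ⟨(hV n).1.pmod hU hR hB, pmod_le (hV n).1.cont hv0 (hV n).2 hR hB⟩
    have h2 := PFam.le_perron h1 (hB (ball_subset_closedBall hw))
    rwa [pmod_in hw] at h2
  have hVW : ∀ n, ∀ w ∈ ball z0 R, V n w ≤ PInt VV z0 R w := by
    intro n w hw
    have h1 := (hV n).1.le_pmod hR hB w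
    rw [pmod_in hw] at h1
    apply h1.trans
    apply Monotone.ge_of_tendsto (f := fun n => PInt (V n) z0 R w) _ (hlim w hw)
    intro a b hab
    exact PInt_mono (hVint a) (hVint b) hw (fun x _ => hVmono hab x)
  have hd : ∀ a, d a ∈ ball z0 R → P (d a) ≤ PInt VV z0 R (d a) := by
    intro a ha
    have h1 : ∀ b : ℕ, P (d a) - 1 / ((b : ℝ) + 1) ≤ PInt VV z0 R (d a) := by
      intro b
      have h2 := hfd (Nat.pair a b)
      simp only [Nat.unpair_pair] at h2
      exact h2.le.trans ((hfV _ _).trans (hVW _ _ ha))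
    have h2 : Tendsto (fun b : ℕ => P (d a) - 1 / ((b : ℝ) + 1)) atTop (𝓝 (P (d a) - 0)) :=
      tendsto_const_nhds.sub tendsto_one_div_add_atTop_nhds_zero_nat
    rw [sub_zero] at h2
    exact le_of_tendsto h2 (Eventually.of_forall h1)
  have hPW : ∀ w ∈ ball z0 R, P w ≤ PInt VV z0 R w := by
    intro w hw
    apply perron_le hne
    intro v hv
    by_contra hlt
    push Not at hlt
    have hb : ball z0 R ⊆ U := ball_subset_closedBall.trans hB
    have ho : IsOpen (ball z0 R ∩ (fun x => v x - PInt VV z0 R x) ⁻¹' Ioi 0) :=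
      ((hv.1.cont.mono hb).sub hW.continuousOn).isOpen_inter_preimage isOpen_ball isOpen_Ioi
    obtain ⟨x, hx, ⟨a, rfl⟩⟩ := (TopologicalSpace.denseRange_denseSeq ℂ).inter_open_nonempty _ ho
      ⟨w, hw, by simpa using hlt⟩
    have h1 := hd a hx.1
    have h2 := PFam.le_perron hv (hb hx.1)
    have h3 := hx.2
    simp only [mem_preimage, mem_Ioi] at h3
    change v (d a) ≤ P (d a) at h2
    change 0 < v (d a) - PInt VV z0 R (d a) at h3
    linarith
  refine (InnerProductSpace.harmonicAt_congr_nhds ?_).1 (hW z0 (mem_ball_self hR))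
  filter_upwards [ball_mem_nhds z0 hR] with w hw
  exact le_antisymm (hWP w hw) (hPW w hw)

lemma perron_symm {v0 : ℂ → ℝ} {U : Set ℂ} (hne : (PFam v0 U).Nonempty)
    (α : ℂ) (φ : ℝ) (hg : ∀ z ∈ U, α + cexp (φ * I) * (starRingEnd ℂ) z ∈ U)
    (hgg : ∀ z, α + cexp (φ * I) * (starRingEnd ℂ) (α + cexp (φ * I) * (starRingEnd ℂ) z) = z)
    (hgv : ∀ z ∈ U, v0 (α + cexp (φ * I) * (starRingEnd ℂ) z) = v0 z) {z : ℂ} (hz : z ∈ U) :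
    perronFn v0 U (α + cexp (φ * I) * (starRingEnd ℂ) z) = perronFn v0 U z := by
  have key : ∀ z ∈ U, perronFn v0 U z ≤ perronFn v0 U (α + cexp (φ * I) * (starRingEnd ℂ) z) := by
    intro z hz
    apply perron_le hne
    intro v hv
    have h1 : (fun z => v (α + cexp (φ * I) * (starRingEnd ℂ) z)) ∈ PFam v0 U :=
      ⟨hv.1.refl α φ hg, fun x hx => (hv.2 _ (hg x hx)).trans (hgv x hx).le⟩
    have h2 := PFam.le_perron h1 (hg z hz)
    simp only [hgg] at h2
    exact h2
  apply le_antisymm _ (key z hz)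
  have := key _ (hg z hz)
  rwa [hgg] at this

/-- the unfolded periodic slit strip -/
def Om (K : ℝ) (m : ℕ) (a k : Fin m → ℝ) : Set ℂ :=
  {z | 0 < z.im ∧ z.im < K ∧
    ∀ i, z.im = k i → Real.cos (Real.pi * a i) < Real.cos (Real.pi * z.re)}

lemma Om_open (K : ℝ) (m : ℕ) (a k : Fin m → ℝ) : IsOpen (Om K m a k) := by
  have : Om K m a k = {z : ℂ | 0 < z.im} ∩ {z : ℂ | z.im < K} ∩
      ⋂ i, ({z : ℂ | z.im ≠ k i} ∪
        {z : ℂ | Real.cos (Real.pi * a i) < Real.cos (Real.pi * z.re)}) := by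
    ext z
    simp only [Om, mem_setOf_eq, mem_inter_iff, mem_iInter, mem_union, and_assoc]
    refine and_congr_right fun _ => and_congr_right fun _ => forall_congr' fun i => ?_
    tauto
  rw [this]
  refine ((isOpen_lt (by fun_prop) (by fun_prop)).inter
    (isOpen_lt (by fun_prop) (by fun_prop))).inter (isOpen_iInter_of_finite fun i => ?_)
  exact (isOpen_ne_fun (by fun_prop) (by fun_prop)).union (isOpen_lt (by fun_prop) (by fun_prop))

lemma cos_lt_iff {a x : ℝ} (ha : 0 < a ∧ a < 1) (hx : 0 ≤ x ∧ x ≤ 1) :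
    Real.cos (Real.pi * a) < Real.cos (Real.pi * x) ↔ x < a := by
  have hp := Real.pi_pos
  rw [Real.strictAntiOn_cos.lt_iff_gt]
  · exact mul_lt_mul_iff_right₀ hp
  · constructor <;> nlinarith
  · constructor <;> nlinarith

lemma slitRect_iff {K : ℝ} {m : ℕ} {a k : Fin m → ℝ} (ha : ∀ i, 0 < a i ∧ a i < 1) (z : ℂ) :
    z ∈ slitRect K m a k ↔ z ∈ Om K m a k ∧ 0 < z.re ∧ z.re < 1 := by
  simp only [slitRect, Om, slitSeg, mem_diff, mem_setOf_eq, mem_iUnion, not_exists]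
  constructor
  · rintro ⟨⟨h1, h2, h3, h4⟩, h5⟩
    refine ⟨⟨h3, h4, fun i hi => ?_⟩, h1, h2⟩
    rw [cos_lt_iff (ha i) ⟨h1.le, h2.le⟩]
    by_contra h
    exact h5 i ⟨not_lt.1 h, h2.le, hi⟩
  · rintro ⟨⟨h3, h4, h5⟩, h1, h2⟩
    refine ⟨⟨h1, h2, h3, h4⟩, fun i hi => ?_⟩
    have := h5 i hi.2.2
    rw [cos_lt_iff (ha i) ⟨h1.le, h2.le⟩] at this
    linarith [hi.1]

lemma slitRect_open {K : ℝ} {m : ℕ} {a k : Fin m → ℝ} (ha : ∀ i, 0 < a i ∧ a i < 1) :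
    IsOpen (slitRect K m a k) := by
  have : slitRect K m a k = Om K m a k ∩ {z : ℂ | 0 < z.re} ∩ {z : ℂ | z.re < 1} := by
    ext z; rw [slitRect_iff ha]; simp [and_assoc]
  rw [this]
  exact ((Om_open K m a k).inter (isOpen_lt (by fun_prop) (by fun_prop))).inter
    (isOpen_lt (by fun_prop) (by fun_prop))

lemma closure_slitRect (K : ℝ) (m : ℕ) (a k : Fin m → ℝ) :
    closure (slitRect K m a k) ⊆ {z | 0 ≤ z.re ∧ z.re ≤ 1 ∧ 0 ≤ z.im ∧ z.im ≤ K} := by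
  apply closure_minimal
  · rintro z ⟨⟨h1, h2, h3, h4⟩, _⟩
    exact ⟨h1.le, h2.le, h3.le, h4.le⟩
  · have : {z : ℂ | 0 ≤ z.re ∧ z.re ≤ 1 ∧ 0 ≤ z.im ∧ z.im ≤ K} =
      {z : ℂ | 0 ≤ z.re} ∩ {z : ℂ | z.re ≤ 1} ∩ {z : ℂ | 0 ≤ z.im} ∩ {z : ℂ | z.im ≤ K} := by
      ext z; simp [and_assoc]
    rw [this]
    exact (((isClosed_le (by fun_prop) (by fun_prop)).inter
      (isClosed_le (by fun_prop) (by fun_prop))).inter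
      (isClosed_le (by fun_prop) (by fun_prop))).inter (isClosed_le (by fun_prop) (by fun_prop))

lemma slitRect_preconnected {K : ℝ} (hK : 0 < K) {m : ℕ} {a k : Fin m → ℝ}
    (ha : ∀ i, 0 < a i ∧ a i < 1) : IsPreconnected (slitRect K m a k) := by
  obtain ⟨α, hα0, hα1, hα⟩ : ∃ α : ℝ, 0 < α ∧ α < 1 ∧ ∀ i, α < a i := by
    have h1 : ∀ᶠ x in 𝓝[>] (0 : ℝ), ∀ i, x < a i := by
      rw [eventually_all]
      intro i
      filter_upwards [Ioo_mem_nhdsGT (ha i).1] with x hx using hx.2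
    obtain ⟨α, h2, h3⟩ := (h1.and (Ioo_mem_nhdsGT (one_pos : (0 : ℝ) < 1))).exists
    exact ⟨α, h3.1, h3.2, h2⟩
  apply isPreconnected_of_forall (⟨α, K / 2⟩ : ℂ)
  rintro y ⟨⟨h1, h2, h3, h4⟩, h5⟩
  simp only [slitSeg, mem_iUnion, mem_setOf_eq, not_exists, not_and] at h5
  refine ⟨segment ℝ y ⟨α, y.im⟩ ∪ segment ℝ ⟨α, y.im⟩ (⟨α, K / 2⟩ : ℂ), ?_,
    Or.inr (right_mem_segment _ _ _), Or.inl (left_mem_segment _ _ _), ?_⟩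
  · rintro x (hx | hx)
    · rw [segment_eq_image'] at hx
      obtain ⟨t, ⟨ht0, ht1⟩, rfl⟩ := hx
      have hb : min y.re α ≤ y.re + t * (α - y.re) ∧ y.re + t * (α - y.re) ≤ max y.re α := by
        rcases le_total y.re α with h | h
        · rw [min_eq_left h, max_eq_right h]
          have e1 := mul_nonneg ht0 (sub_nonneg.2 h)
          have e2 := mul_le_of_le_one_left (sub_nonneg.2 h) ht1
          constructor <;> linarith
        · rw [min_eq_right h, max_eq_left h]
          have e1 := mul_nonneg ht0 (sub_nonneg.2 h)
          have e2 := mul_le_of_le_one_left (sub_nonneg.2 h) ht1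
          constructor <;> linarith
      refine ⟨⟨?_, ?_, ?_, ?_⟩, ?_⟩
      · simpa using (lt_min h1 hα0).trans_le hb.1
      · simpa using hb.2.trans_lt (max_lt h2 hα1)
      · simpa using h3
      · simpa using h4
      · simp only [slitSeg, mem_iUnion, mem_setOf_eq, not_exists, not_and]
        intro i hi1 hi2 hi3
        simp at hi1 hi2 hi3
        refine h5 i ?_ h2.le hi3
        rcases le_max_iff.1 (hi1.trans hb.2) with h | h
        · exact h
        · linarith [hα i]
    · rw [segment_eq_image'] at hx
      obtain ⟨t, ⟨ht0, ht1⟩, rfl⟩ := hx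
      refine ⟨⟨?_, ?_, ?_, ?_⟩, ?_⟩
      · simpa using hα0
      · simpa using hα1
      · simp; nlinarith
      · simp; nlinarith
      · simp only [slitSeg, mem_iUnion, mem_setOf_eq, not_exists, not_and]
        intro i hi1
        simp at hi1
        linarith [hα i]
  · exact IsPreconnected.union _ (right_mem_segment _ _ _) (left_mem_segment _ _ _)
      (convex_segment _ _).isPreconnected (convex_segment _ _).isPreconnected

lemma isHarmonicOn_of {f : ℂ → ℝ} {U : Set ℂ} (h : InnerProductSpace.HarmonicOnNhd f U) :
    IsHarmonicOn f U := by
  refine ⟨h.contDiffOn, fun z hz => ?_⟩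
  have := (h z hz).2.self_of_nhds
  rw [InnerProductSpace.laplacian_eq_iteratedFDeriv_complexPlane] at this
  simpa using this

lemma even_deriv {f : ℝ → ℝ} (hd : DifferentiableAt ℝ f 0) (he : ∀ᶠ x in 𝓝 0, f (-x) = f x) :
    Tendsto (fun ε : ℝ => (f ε - f 0) / ε) (𝓝[>] (0 : ℝ)) (𝓝 0) := by
  have h1 : HasDerivAt f (deriv f 0) 0 := hd.hasDerivAt
  have h2 : HasDerivAt (fun x => f (-x)) (-deriv f 0) 0 := by
    have h3 : HasDerivAt f (deriv f 0) (-0) := by simpa using h1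
    have h4 := h3.comp (0 : ℝ) (hasDerivAt_neg (0 : ℝ))
    rw [mul_neg_one] at h4
    exact h4
  have h3 : HasDerivAt f (-deriv f 0) 0 := h2.congr_of_eventuallyEq (by
    filter_upwards [he] with x hx using hx.symm)
  have h4 : deriv f 0 = 0 := by linarith [h1.unique h3]
  rw [h4, hasDerivAt_iff_tendsto_slope] at h1
  have h5 := h1.mono_left (nhdsWithin_mono (0 : ℝ) (fun x (hx : 0 < x) => (ne_of_gt hx)))
  refine h5.congr fun x => ?_
  simp [slope_def_field]

lemma refl_eq (c : ℝ) (z : ℂ) :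
    (2 * c : ℂ) - (starRingEnd ℂ) z = 2 * c + cexp ((Real.pi : ℝ) * I) * (starRingEnd ℂ) z := by
  rw [Complex.exp_pi_mul_I]; ring

lemma Om_refl {K : ℝ} {m : ℕ} {a k : Fin m → ℝ} {c : ℝ} (hc : c = 0 ∨ c = 1) {z : ℂ}
    (hz : z ∈ Om K m a k) : (2 * c : ℂ) - (starRingEnd ℂ) z ∈ Om K m a k := by
  have hre : ((2 * c : ℂ) - (starRingEnd ℂ) z).re = 2 * c - z.re := by simp
  have him : ((2 * c : ℂ) - (starRingEnd ℂ) z).im = z.im := by simp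
  have hcos : Real.cos (Real.pi * (2 * c - z.re)) = Real.cos (Real.pi * z.re) := by
    rcases hc with rfl | rfl
    · simp
    · rw [← Real.cos_two_pi_sub]; ring_nf
  simp only [Om, mem_setOf_eq, hre, him, hcos]
  exact hz

theorem kernel_of_barrier {K : ℝ} (hK : 0 < K) {m : ℕ} {a k : Fin m → ℝ}
    (ha : ∀ i, 0 < a i ∧ a i < 1) (hk : ∀ i, 0 < k i ∧ k i < K) {w : ℂ} {v0 s : ℂ → ℝ}
    (hv0 : LSub (fun z => - v0 z) (Om K m a k)) (hs : LSub s (Om K m a k))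
    (hs0 : ∀ z ∈ Om K m a k, 0 ≤ s z) (hsv : ∀ z ∈ Om K m a k, s z ≤ v0 z)
    (hpos : ∃ z ∈ slitRect K m a k, 0 < s z)
    (hsym : ∀ c : ℝ, c = 0 ∨ c = 1 → ∀ z ∈ Om K m a k,
      v0 ((2 * c : ℂ) - (starRingEnd ℂ) z) = v0 z)
    (hbd : ∀ ζ : ℂ, 0 ≤ ζ.re → ζ.re ≤ 1 → 0 ≤ ζ.im → ζ.im ≤ K → ζ ∉ Om K m a k → ζ ≠ w →
      Tendsto v0 (𝓝[Om K m a k] ζ) (𝓝 0))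
    (hpole : ∃ r > 0, ∃ C : ℝ, ∀ z ∈ slitRect K m a k ∩ ball w r,
      v0 z ≤ (1 / Real.pi) * |(1 / (z - w)).im| + C ∧
      (1 / Real.pi) * |(1 / (z - w)).im| - C ≤ s z) :
    ∃ P H : ℂ → ℝ, IsMixedPoissonKernel K m a k w P H := by
  set U := Om K m a k with hUdef
  have hU : IsOpen U := Om_open K m a k
  have hDU : slitRect K m a k ⊆ U := fun z hz => ((slitRect_iff ha z).1 hz).1
  have hsF : s ∈ PFam v0 U := ⟨hs, hsv⟩
  have hne : (PFam v0 U).Nonempty := ⟨s, hsF⟩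
  have hharm := perron_harmonic hU hv0 hne
  let H : ℂ → ℝ := U.indicator (perronFn v0 U)
  have hHU : ∀ z ∈ U, H z = perronFn v0 U z := fun z hz => indicator_of_mem hz _
  have hHn : ∀ z ∉ U, H z = 0 := fun z hz => indicator_of_notMem hz _
  have hH : InnerProductSpace.HarmonicOnNhd H U := by
    intro z hz
    refine (InnerProductSpace.harmonicAt_congr_nhds ?_).1 (hharm z hz)
    filter_upwards [hU.mem_nhds hz] with x hx using (hHU x hx).symm
  have hsP : ∀ z ∈ U, s z ≤ H z := fun z hz => by rw [hHU z hz]; exact PFam.le_perron hsF hz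
  have hP0 : ∀ z ∈ U, 0 ≤ H z := fun z hz => (hs0 z hz).trans (hsP z hz)
  have hPv : ∀ z ∈ U, H z ≤ v0 z := fun z hz => by
    rw [hHU z hz]; exact perron_le hne (fun v hv => hv.2 z hz)
  have hHsym : ∀ c : ℝ, c = 0 ∨ c = 1 → ∀ z ∈ U, H ((2 * c : ℂ) - (starRingEnd ℂ) z) = H z := by
    intro c hc z hz
    rw [hHU z hz, hHU _ (Om_refl hc hz), refl_eq]
    refine perron_symm hne (2 * c) Real.pi (fun x hx => ?_) (fun x => ?_) (fun x hx => ?_) hz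
    · rw [← refl_eq]; exact Om_refl hc hx
    · rw [← refl_eq, ← refl_eq]; apply Complex.ext <;> simp
    · rw [← refl_eq]; exact hsym c hc x hx
  have hNU : gammaN K m k ⊆ U := by
    rintro z (⟨h1, h2, h3⟩ | ⟨h1, h2, h3, h4⟩)
    · refine ⟨h2, h3, fun i _ => ?_⟩
      rw [cos_lt_iff (ha i) ⟨h1.ge, by linarith⟩, h1]
      exact (ha i).1
    · exact ⟨h2, h3, fun i hi => absurd hi (h4 i)⟩
  have hDn : ∀ z ∈ gammaD K m a k, z ∉ U := by
    rintro z ((⟨_, _, h⟩ | ⟨_, _, h⟩) | h) hzU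
    · exact absurd hzU.1 (by rw [h]; exact lt_irrefl _)
    · exact absurd hzU.2.1 (by rw [h]; exact lt_irrefl _)
    · obtain ⟨i, h1, h2, h3⟩ := mem_iUnion.1 h
      have := hzU.2.2 i h3
      rw [cos_lt_iff (ha i) ⟨(ha i).1.le.trans h1, h2⟩] at this
      linarith
  refine ⟨H, H, isHarmonicOn_of (hH.mono hDU), ?_, ?_, fun _ _ => rfl, ?_, ?_, ?_⟩
  · obtain ⟨z1, hz1, hp⟩ := hpos
    exact strong_min (slitRect_open ha) (slitRect_preconnected hK ha) (hH.mono hDU)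
      (fun y hy => hP0 y (hDU hy)) hz1 (hp.trans_le (hsP z1 (hDU hz1)))
  · rintro ζ ⟨hζ, hζw⟩
    by_cases hζU : ζ ∈ U
    · exact (hH.continuousOn.continuousAt (hU.mem_nhds hζU)).continuousWithinAt
    · obtain ⟨h1, h2, h3, h4⟩ := closure_slitRect K m a k hζ
      have hlim := hbd ζ h1 h2 h3 h4 hζU hζw
      apply ContinuousAt.continuousWithinAt
      unfold ContinuousAt
      rw [hHn ζ hζU, Metric.tendsto_nhds]
      intro ε hε
      have h5 := (Metric.tendsto_nhds.1 hlim) ε hε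
      rw [eventually_nhdsWithin_iff] at h5
      filter_upwards [h5] with x hx
      by_cases hxU : x ∈ U
      · have h6 := hx hxU
        have h7 := hP0 x hxU
        have h8 := hPv x hxU
        rw [Real.dist_eq, sub_zero] at h6 ⊢
        rw [abs_of_nonneg h7]
        exact (h8.trans (le_abs_self _)).trans_lt h6
      · rw [hHn x hxU]; simpa using hε
  · rintro z ⟨hz, _⟩
    exact hHn z (hDn z hz)
  · intro ζ hζ
    have hζU := hNU hζ
    have hdiff : DifferentiableAt ℝ H ζ := (hH ζ hζU).1.differentiableAt (by norm_num)
    let f : ℝ → ℝ := fun ε => H (ζ + (ε : ℂ) * innerNormal ζ)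
    have hcont : Continuous (fun ε : ℝ => ζ + (ε : ℂ) * innerNormal ζ) := by fun_prop
    have hf : DifferentiableAt ℝ f 0 := by
      have h1 : DifferentiableAt ℝ (fun ε : ℝ => ζ + (ε : ℂ) * innerNormal ζ) 0 := by
        have : DifferentiableAt ℝ (fun ε : ℝ => (ε : ℂ)) 0 := Complex.ofRealCLM.differentiableAt
        fun_prop
      have h2 : DifferentiableAt ℝ H (ζ + ((0 : ℝ) : ℂ) * innerNormal ζ) := by simpa using hdiff
      exact h2.comp (0 : ℝ) h1
    have he : ∀ᶠ x in 𝓝 (0 : ℝ), f (-x) = f x := by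
      have h1 : ∀ᶠ x : ℝ in 𝓝 (0 : ℝ), ζ + (x : ℂ) * innerNormal ζ ∈ U := by
        apply hcont.continuousAt.eventually_mem
        exact hU.mem_nhds (by simpa using hζU)
      filter_upwards [h1] with x hx
      obtain ⟨c, hc, hcz⟩ : ∃ c : ℝ, (c = 0 ∨ c = 1) ∧ ζ.re = c := by
        rcases hζ with h | h
        · exact ⟨0, Or.inl rfl, h.1⟩
        · exact ⟨1, Or.inr rfl, h.1⟩
      have hn : ∃ t : ℝ, innerNormal ζ = t := by
        unfold innerNormal
        split_ifs
        · exact ⟨1, by simp⟩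
        · exact ⟨-1, by simp⟩
      obtain ⟨t, ht⟩ := hn
      have h2 := hHsym c hc _ hx
      simp only [f]
      rw [← h2]
      congr 1
      rw [ht]
      apply Complex.ext
      · simp [hcz]; ring
      · simp
    have := even_deriv hf he
    simpa [f] using this
  · obtain ⟨r, hr, C, h⟩ := hpole
    refine ⟨r, hr, C, fun z hz => ?_⟩
    obtain ⟨h1, h2⟩ := h z hz
    have h3 := hPv z (hDU hz.1)
    have h4 := hsP z (hDU hz.1)
    rw [abs_le]
    constructor <;> linarith

/-- the exponential coordinate -/
def ez (z : ℂ) : ℂ := cexp (Real.pi * I * z)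

/-- the periodic half-plane Poisson kernel -/
def Qk (z : ℂ) : ℝ := ((1 + ez z) / (1 - ez z)).re

lemma norm_ez (z : ℂ) : ‖ez z‖ = Real.exp (-(Real.pi * z.im)) := by
  rw [ez, Complex.norm_exp]
  congr 1
  simp

lemma norm_ez_lt {z : ℂ} (hz : 0 < z.im) : ‖ez z‖ < 1 := by
  rw [norm_ez, Real.exp_lt_one_iff]
  have := mul_pos Real.pi_pos hz
  linarith

lemma one_sub_ez_ne {z : ℂ} (hz : 0 < z.im) : 1 - ez z ≠ 0 := by
  intro h
  have h1 := norm_ez_lt hz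
  rw [← sub_eq_zero.1 h] at h1
  simp at h1

lemma Qk_eq (z : ℂ) : Qk z = (1 - ‖ez z‖ ^ 2) / ‖1 - ez z‖ ^ 2 := by
  rw [Qk, Complex.div_re, ← Complex.normSq_eq_norm_sq, ← Complex.normSq_eq_norm_sq]
  rw [Complex.normSq_apply (ez z)]
  simp
  ring

lemma Qk_pos {z : ℂ} (hz : 0 < z.im) : 0 < Qk z := by
  rw [Qk_eq]
  have h1 := norm_ez_lt hz
  have h2 := norm_pos_iff.2 (one_sub_ez_ne hz)
  have h3 := norm_nonneg (ez z)
  apply div_pos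
  · nlinarith
  · positivity

lemma Qk_cont {z : ℂ} (hz : ez z ≠ 1) : ContinuousAt Qk z := by
  have h1 : 1 - ez z ≠ 0 := fun h => hz (sub_eq_zero.1 h).symm
  have h2 : ContinuousAt ez z := by unfold ez; fun_prop
  unfold Qk
  exact Complex.continuous_re.continuousAt.comp ((continuousAt_const.add h2).div
    (continuousAt_const.sub h2) h1)

lemma Qk_real {z : ℂ} (hz : z.im = 0) : Qk z = 0 := by
  rw [Qk_eq, norm_ez, hz]; simp

lemma Qk_harm {z : ℂ} (hz : 0 < z.im) (c : ℂ) (hc : c.im = 0) :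
    InnerProductSpace.HarmonicAt (fun z => Qk (z + c)) z := by
  have h1 : 1 - ez (z + c) ≠ 0 := one_sub_ez_ne (by simpa [hc] using hz)
  have h2 : AnalyticAt ℂ (fun z => ez (z + c)) z := by unfold ez; fun_prop
  have h3 : AnalyticAt ℂ (fun z => (1 + ez (z + c)) / (1 - ez (z + c))) z :=
    (analyticAt_const.add h2).div (analyticAt_const.sub h2) h1
  exact h3.harmonicAt_re

lemma ez_refl {c : ℝ} (hc : c = 0 ∨ c = 1) (z : ℂ) :
    ez ((2 * c : ℂ) - (starRingEnd ℂ) z) = (starRingEnd ℂ) (ez z) := by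
  unfold ez
  rw [← Complex.exp_conj]
  rcases hc with rfl | rfl
  · congr 1; simp
  · rw [mul_sub, Complex.exp_sub]
    have : (Real.pi : ℂ) * I * (2 * (1 : ℝ)) = 2 * Real.pi * I := by push_cast; ring
    rw [this, Complex.exp_two_pi_mul_I, one_div, ← Complex.exp_neg]
    congr 1; simp

lemma Qk_refl {c : ℝ} (hc : c = 0 ∨ c = 1) (z : ℂ) :
    Qk ((2 * c : ℂ) - (starRingEnd ℂ) z) = Qk z := by
  rw [Qk_eq, Qk_eq, ez_refl hc]
  have : 1 - (starRingEnd ℂ) (ez z) = (starRingEnd ℂ) (1 - ez z) := by simp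
  rw [this, Complex.norm_conj, Complex.norm_conj]

lemma Qk_bdd {δ : ℝ} (hδ : 0 < δ) : ∃ C : ℝ, ∀ z : ℂ, δ ≤ z.im → Qk z ≤ C := by
  set ρ := Real.exp (-(Real.pi * δ)) with hρ
  have hρ1 : ρ < 1 := by
    rw [hρ, Real.exp_lt_one_iff]
    have := mul_pos Real.pi_pos hδ
    linarith
  refine ⟨1 / (1 - ρ) ^ 2, fun z hz => ?_⟩
  rw [Qk_eq]
  have h1 : ‖ez z‖ ≤ ρ := by
    rw [norm_ez, hρ, Real.exp_le_exp]
    have := mul_le_mul_of_nonneg_left hz Real.pi_pos.le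
    linarith
  have h2 : 1 - ρ ≤ ‖1 - ez z‖ := by
    have := norm_sub_norm_le (1 : ℂ) (ez z)
    rw [norm_one] at this
    linarith
  have h3 : 0 < 1 - ρ := by linarith
  gcongr
  have := sq_nonneg ‖ez z‖
  linarith

lemma Qk_pole {z : ℂ} (hz : z ≠ 0) (hs : Real.pi * ‖z‖ ≤ 1 / 2) :
    |Qk z + 2 / Real.pi * (1 / z).im| ≤ 5 := by
  set u : ℂ := Real.pi * I * z with hu
  have hpi := Real.pi_pos
  have hun : ‖u‖ = Real.pi * ‖z‖ := by simp [hu, abs_of_pos hpi]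
  have hu0 : u ≠ 0 := by simp [hu, hz, Real.pi_ne_zero]
  have hu1 : 0 < ‖u‖ := norm_pos_iff.2 hu0
  have hu2 : ‖u‖ ≤ 1 / 2 := by rw [hun]; exact hs
  have he := Complex.norm_exp_sub_one_sub_id_le (x := u) (by linarith)
  have hlow : ‖u‖ / 2 ≤ ‖1 - cexp u‖ := by
    have h1 := norm_sub_norm_le u (-(cexp u - 1 - u))
    have h2 : u - -(cexp u - 1 - u) = -(1 - cexp u) := by ring
    rw [h2, norm_neg, norm_neg] at h1
    nlinarith
  have h1e : 1 - cexp u ≠ 0 := by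
    rw [← norm_pos_iff]; linarith
  have hb : ‖1 / (1 - cexp u) + 1 / u‖ ≤ 2 := by
    have : 1 / (1 - cexp u) + 1 / u = -(cexp u - 1 - u) / ((1 - cexp u) * u) := by
      field_simp; ring
    rw [this, norm_div, norm_neg, norm_mul, div_le_iff₀ (by positivity)]
    nlinarith
  have hq : Qk z + 2 / Real.pi * (1 / z).im = (-1 + 2 * (1 / (1 - cexp u) + 1 / u)).re := by
    have h1 : (1 + ez z) / (1 - ez z) = -1 + 2 * (1 / (1 - cexp u)) := by
      have : ez z = cexp u := rfl
      rw [this]; field_simp; ring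
    have h2 : (2 * (1 / u)).re = 2 / Real.pi * (1 / z).im := by
      have : 2 * (1 / u) = ((2 / Real.pi : ℝ) : ℂ) * (-I * (1 / z)) := by
        rw [hu]; push_cast
        have : (Real.pi : ℂ) ≠ 0 := by exact_mod_cast hpi.ne'
        field_simp
        rw [Complex.I_sq]; ring
      rw [this, Complex.re_ofReal_mul]
      simp
    rw [Qk, h1, ← h2, mul_add, ← add_assoc, ← Complex.add_re]
  rw [hq]
  refine (Complex.abs_re_le_norm _).trans ((norm_add_le _ _).trans ?_)
  rw [norm_neg, norm_one, norm_mul]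
  have : ‖(2 : ℂ)‖ = 2 := by simp
  rw [this]; linarith

lemma ez_ne_one {z : ℂ} (h : -2 < z.re ∧ z.re < 2) (hz : z ≠ 0) : ez z ≠ 1 := by
  intro h1
  rw [ez, Complex.exp_eq_one_iff] at h1
  obtain ⟨n, hn⟩ := h1
  have hpi : (Real.pi : ℂ) ≠ 0 := by exact_mod_cast Real.pi_ne_zero
  have h2 : z = 2 * n := by
    have : (Real.pi : ℂ) * I * z = Real.pi * I * (2 * n) := by rw [hn]; ring
    exact mul_left_cancel₀ (mul_ne_zero hpi I_ne_zero) this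
  have h3 : z.re = 2 * n := by rw [h2]; simp
  rw [h3] at h
  have h4 : (-1 : ℤ) < n := by
    have : ((-1 : ℤ) : ℝ) < n := by push_cast; linarith
    exact_mod_cast this
  have h5 : n < (1 : ℤ) := by
    have : (n : ℝ) < ((1 : ℤ) : ℝ) := by push_cast; linarith
    exact_mod_cast this
  have : n = 0 := by omega
  apply hz; rw [h2, this]; simp

/-- the symmetrized kernel -/
def hk0 (x : ℝ) (z : ℂ) : ℝ := (Qk (z + ((-x : ℝ) : ℂ)) + Qk (z + (x : ℂ))) / 2

lemma hk0_pos (x : ℝ) {z : ℂ} (hz : 0 < z.im) : 0 < hk0 x z := by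
  unfold hk0
  have h1 := Qk_pos (z := z + ((-x : ℝ) : ℂ)) (by simpa using hz)
  have h2 := Qk_pos (z := z + (x : ℂ)) (by simpa using hz)
  linarith

lemma hk0_harm (x : ℝ) {z : ℂ} (hz : 0 < z.im) : InnerProductSpace.HarmonicAt (hk0 x) z := by
  have h1 := Qk_harm hz ((-x : ℝ) : ℂ) (by simp)
  have h2 := Qk_harm hz (x : ℂ) (by simp)
  have h3 := (h1.add h2).const_smul (c := (1 / 2 : ℝ))
  convert h3 using 1
  ext y
  simp [hk0]; ring

lemma hk0_refl (x : ℝ) {c : ℝ} (hc : c = 0 ∨ c = 1) (z : ℂ) :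
    hk0 x ((2 * c : ℂ) - (starRingEnd ℂ) z) = hk0 x z := by
  unfold hk0
  have h1 : (2 * c : ℂ) - (starRingEnd ℂ) z + ((-x : ℝ) : ℂ) =
    (2 * c : ℂ) - (starRingEnd ℂ) (z + x) := by simp; ring
  have h2 : (2 * c : ℂ) - (starRingEnd ℂ) z + (x : ℂ) =
    (2 * c : ℂ) - (starRingEnd ℂ) (z + ((-x : ℝ) : ℂ)) := by simp; ring
  rw [h1, h2, Qk_refl hc, Qk_refl hc]; ring

lemma hk0_bdd (x : ℝ) {δ : ℝ} (hδ : 0 < δ) : ∃ C : ℝ, ∀ z : ℂ, δ ≤ z.im → hk0 x z ≤ C := by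
  obtain ⟨C, hC⟩ := Qk_bdd hδ
  refine ⟨C, fun z hz => ?_⟩
  have h1 := hC (z + ((-x : ℝ) : ℂ)) (by simpa using hz)
  have h2 := hC (z + (x : ℂ)) (by simpa using hz)
  unfold hk0; linarith

lemma hk0_tendsto {x : ℝ} (hx : 0 < x ∧ x < 1) {ζ : ℂ} (h0 : 0 ≤ ζ.re) (h1 : ζ.re ≤ 1)
    (him : ζ.im = 0) (hne : ζ ≠ x) : Tendsto (hk0 x) (𝓝 ζ) (𝓝 0) := by
  have hc : ContinuousAt (hk0 x) ζ := by
    unfold hk0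
    have e1 : ContinuousAt Qk (ζ + ((-x : ℝ) : ℂ)) := Qk_cont (ez_ne_one
      (by simp; constructor <;> linarith) (by
        intro h; apply hne; push_cast at h; linear_combination h))
    have e2 : ContinuousAt Qk (ζ + (x : ℂ)) := Qk_cont (ez_ne_one
      (by simp; constructor <;> linarith) (by
        intro h
        have := congrArg Complex.re h
        simp at this; linarith))
    have e3 : ContinuousAt (fun z => Qk (z + ((-x : ℝ) : ℂ))) ζ :=
      ContinuousAt.comp (f := fun z : ℂ => z + ((-x : ℝ) : ℂ)) (g := Qk) e1 (by fun_prop)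
    have e4 : ContinuousAt (fun z => Qk (z + (x : ℂ))) ζ :=
      ContinuousAt.comp (f := fun z : ℂ => z + (x : ℂ)) (g := Qk) e2 (by fun_prop)
    exact (e3.add e4).div_const 2
  have h0 : hk0 x ζ = 0 := by
    unfold hk0
    rw [Qk_real (by simpa using him), Qk_real (by simpa using him)]; simp
  have := hc.tendsto
  rwa [h0] at this

lemma hk0_pole {x : ℝ} (hx : 0 < x ∧ x < 1) : ∃ r > 0, ∃ C : ℝ, ∀ z : ℂ, 0 < z.im →
    z ∈ ball (x : ℂ) r → _root_.abs (hk0 x z - (1 / Real.pi) * |(1 / (z - x)).im|) ≤ C := by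
  have e2 : ContinuousAt Qk ((x : ℂ) + (x : ℂ)) := Qk_cont (ez_ne_one
      (by simp; constructor <;> linarith) (by
        intro h
        have := congrArg Complex.re h
        simp at this; linarith))
  have e4 : ContinuousAt (fun z => Qk (z + (x : ℂ))) (x : ℂ) :=
    ContinuousAt.comp (f := fun z : ℂ => z + (x : ℂ)) (g := Qk) e2 (by fun_prop)
  obtain ⟨r1, hr1, h1⟩ := Metric.continuousAt_iff.1 e4 1 one_pos
  have hpi := Real.pi_pos
  refine ⟨min r1 (1 / (2 * Real.pi)), by positivity, 5 + (1 + |Qk (x + x)|), ?_⟩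
  intro z hz hzb
  rw [mem_ball] at hzb
  have h2 := h1 (hzb.trans_le (min_le_left _ _))
  rw [Real.dist_eq] at h2
  have h3 : z - x ≠ 0 := by
    intro h
    have := congrArg Complex.im h
    simp at this; linarith
  have h4 := Qk_pole h3 (by
    rw [← dist_eq_norm]
    have := (hzb.trans_le (min_le_right _ _)).le
    rw [le_div_iff₀ (by positivity)] at this
    linarith)
  have h5 : (1 / (z - x)).im ≤ 0 := by
    rw [one_div, Complex.inv_im]
    apply div_nonpos_of_nonpos_of_nonneg
    · simpa using hz.le
    · exact Complex.normSq_nonneg _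
  have h6 : z + ((-x : ℝ) : ℂ) = z - x := by push_cast; ring
  unfold hk0
  rw [abs_of_nonpos h5, h6]
  have h7 : |Qk (z + x)| ≤ 1 + |Qk (x + x)| := by
    have := abs_sub_abs_le_abs_sub (Qk (z + x)) (Qk (x + x))
    linarith
  have h8 : (Qk (z - x) + Qk (z + x)) / 2 - 1 / Real.pi * -(1 / (z - x)).im =
    (Qk (z - x) + 2 / Real.pi * (1 / (z - x)).im) / 2 + Qk (z + x) / 2 := by ring
  rw [h8]
  refine (abs_add_le _ _).trans ?_
  rw [abs_div, abs_div, abs_two]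
  have := abs_nonneg (Qk (x + x))
  linarith

/-- real part of the principal square root -/
def rt (u : ℂ) : ℝ := √((‖u‖ + u.re) / 2)

lemma rt_cont : Continuous rt := by unfold rt; fun_prop

lemma rt_harm {f : ℂ → ℂ} {z : ℂ} (hf : AnalyticAt ℂ f z) (h : f z ∈ slitPlane) :
    InnerProductSpace.HarmonicAt (fun z => rt (f z)) z := by
  have h1 : AnalyticAt ℂ (fun z => f z ^ (2⁻¹ : ℂ)) z := hf.cpow analyticAt_const h
  have h2 := h1.harmonicAt_re
  simp only [cpow_inv_two_re] at h2
  exact h2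

lemma rt_pos {u : ℂ} (h : u ∈ slitPlane) : 0 < rt u := by
  unfold rt
  apply Real.sqrt_pos.2
  have h1 := Complex.abs_re_le_norm u
  have h2 := abs_le.1 h1
  rcases h with h | h
  · linarith [norm_nonneg u]
  · have h3 : |u.re| ≠ ‖u‖ := fun h3 => h (Complex.abs_re_eq_norm.1 h3)
    have h4 := lt_of_le_of_ne h1 h3
    have h5 := neg_abs_le u.re
    linarith

lemma rt_zero {t : ℝ} (h : t ≤ 0) : rt (t : ℂ) = 0 := by
  simp [rt, abs_of_nonpos h]

lemma rt_conj (u : ℂ) : rt ((starRingEnd ℂ) u) = rt u := by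
  simp [rt]

/-- the coordinate used for the slit at height `k` -/
def Zc (k : ℝ) (z : ℂ) : ℂ := Complex.cos (Real.pi * (z - k * I))

def g1 (q k : ℝ) (z : ℂ) : ℂ := (Zc k z - q) / (Zc k z + 1)
def g2 (q k : ℝ) (z : ℂ) : ℂ := (Zc k z + 1) / (Zc k z - q)

lemma Zc_refl (k : ℝ) {c : ℝ} (hc : c = 0 ∨ c = 1) (z : ℂ) :
    Zc k ((2 * c : ℂ) - (starRingEnd ℂ) z) = (starRingEnd ℂ) (Zc k z) := by
  unfold Zc
  rw [← Complex.cos_conj]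
  rcases hc with rfl | rfl
  · rw [← Complex.cos_neg]; congr 1; simp; ring
  · rw [← Complex.cos_two_pi_sub]; congr 1; simp; ring

lemma g1_refl (q k : ℝ) {c : ℝ} (hc : c = 0 ∨ c = 1) (z : ℂ) :
    g1 q k ((2 * c : ℂ) - (starRingEnd ℂ) z) = (starRingEnd ℂ) (g1 q k z) := by
  simp [g1, Zc_refl k hc]

lemma g2_refl (q k : ℝ) {c : ℝ} (hc : c = 0 ∨ c = 1) (z : ℂ) :
    g2 q k ((2 * c : ℂ) - (starRingEnd ℂ) z) = (starRingEnd ℂ) (g2 q k z) := by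
  simp [g2, Zc_refl k hc]

lemma Zc_eq (k : ℝ) (z : ℂ) : Zc k z =
    ((Real.cos (Real.pi * z.re) * Real.cosh (Real.pi * (z.im - k)) : ℝ) : ℂ) -
    ((Real.sin (Real.pi * z.re) * Real.sinh (Real.pi * (z.im - k)) : ℝ) : ℂ) * I := by
  have : (Real.pi : ℂ) * (z - k * I) =
      ((Real.pi * z.re : ℝ) : ℂ) + ((Real.pi * (z.im - k) : ℝ) : ℂ) * I := by
    apply Complex.ext <;> simp
  rw [Zc, this, Complex.cos_add_mul_I]
  push_cast; ring

lemma Zc_slit {k : ℝ} {z : ℂ} (h : z.im = k) : Zc k z = (Real.cos (Real.pi * z.re) : ℝ) := by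
  rw [Zc_eq, h]; simp

lemma Zc_not_seg {q k : ℝ} (hq : q < 1) {z : ℂ}
    (hz : z.im = k → q < Real.cos (Real.pi * z.re)) (t : ℝ) (h1 : -1 ≤ t) (h2 : t ≤ q) :
    Zc k z ≠ t := by
  intro h
  by_cases hk : z.im = k
  · rw [Zc_slit hk] at h
    have h3 : Real.cos (Real.pi * z.re) = t := by exact_mod_cast h
    linarith [hz hk]
  · rw [Zc_eq] at h
    have hre := congrArg Complex.re h
    have him := congrArg Complex.im h
    simp only [sub_re, ofReal_re, mul_re, I_re, mul_zero, I_im, ofReal_im, sub_im, mul_im,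
      mul_one, zero_add, zero_sub, sub_zero, neg_eq_zero, add_zero] at hre him
    have hy : Real.pi * (z.im - k) ≠ 0 := mul_ne_zero Real.pi_ne_zero (sub_ne_zero.2 hk)
    have hs : Real.sin (Real.pi * z.re) = 0 := by
      rcases mul_eq_zero.1 him with h | h
      · exact h
      · exact absurd (Real.sinh_eq_zero.1 h) hy
    have hc := Real.one_lt_cosh.2 hy
    rcases Real.sin_eq_zero_iff_cos_eq.1 hs with h | h
    · rw [h] at hre; linarith
    · rw [h] at hre; linarith

lemma g_slitPlane {q k : ℝ} (hq : -1 < q ∧ q < 1) {z : ℂ}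
    (hz : z.im = k → q < Real.cos (Real.pi * z.re)) :
    g1 q k z ∈ slitPlane ∧ g2 q k z ∈ slitPlane ∧ Zc k z + 1 ≠ 0 ∧ Zc k z - q ≠ 0 := by
  have hns := Zc_not_seg hq.2 hz
  have h1 : Zc k z + 1 ≠ 0 := by
    intro h
    apply hns (-1) le_rfl hq.1.le
    push_cast; linear_combination h
  have h2 : Zc k z - q ≠ 0 := by
    intro h
    apply hns q hq.1.le le_rfl
    linear_combination h
  have h3 : g1 q k z ∈ slitPlane := by
    by_contra h
    rw [mem_slitPlane_iff] at h
    push Not at h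
    obtain ⟨t, ht, hgt⟩ : ∃ t : ℝ, t ≤ 0 ∧ g1 q k z = t :=
      ⟨(g1 q k z).re, h.1, by apply Complex.ext <;> simp [h.2]⟩
    rw [g1, div_eq_iff h1] at hgt
    have h1t : 0 < 1 - t := by linarith
    apply hns ((q + t) / (1 - t))
    · rw [le_div_iff₀ h1t]; linarith
    · rw [div_le_iff₀ h1t]; nlinarith
    · push_cast
      have : (1 - t : ℂ) ≠ 0 := by exact_mod_cast h1t.ne'
      rw [eq_div_iff this]
      linear_combination hgt
  refine ⟨h3, ?_, h1, h2⟩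
  have : g2 q k z = (g1 q k z)⁻¹ := by rw [g1, g2, inv_div]
  rw [this]
  have hn : 0 < Complex.normSq (g1 q k z) := Complex.normSq_pos.2 (slitPlane_ne_zero h3)
  rcases mem_slitPlane_iff.1 h3 with h | h
  · left
    rw [Complex.inv_re]
    exact div_pos h hn
  · right
    rw [Complex.inv_im]
    exact div_ne_zero (neg_ne_zero.2 h) hn.ne'

lemma Zc_analytic (k : ℝ) (z : ℂ) : AnalyticAt ℂ (Zc k) z := by unfold Zc; fun_prop

lemma rt_g1_harm {q k : ℝ} (hq : -1 < q ∧ q < 1) {z : ℂ}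
    (hz : z.im = k → q < Real.cos (Real.pi * z.re)) :
    InnerProductSpace.HarmonicAt (fun z => rt (g1 q k z)) z := by
  obtain ⟨h1, h2, h3, h4⟩ := g_slitPlane hq hz
  exact rt_harm (((Zc_analytic k z).sub analyticAt_const).div
    ((Zc_analytic k z).add analyticAt_const) h3) h1

lemma rt_g2_harm {q k : ℝ} (hq : -1 < q ∧ q < 1) {z : ℂ}
    (hz : z.im = k → q < Real.cos (Real.pi * z.re)) :
    InnerProductSpace.HarmonicAt (fun z => rt (g2 q k z)) z := by
  obtain ⟨h1, h2, h3, h4⟩ := g_slitPlane hq hz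
  exact rt_harm (((Zc_analytic k z).add analyticAt_const).div
    ((Zc_analytic k z).sub analyticAt_const) h4) h2

lemma rt_g_tendsto {q k : ℝ} (hq : -1 < q ∧ q < 1) {z : ℂ} (hk : z.im = k)
    (hz : Real.cos (Real.pi * z.re) ≤ q) :
    Tendsto (fun z => rt (g1 q k z)) (𝓝 z) (𝓝 0) ∨ Tendsto (fun z => rt (g2 q k z)) (𝓝 z) (𝓝 0) := by
  have hZ := Zc_slit hk
  set t := Real.cos (Real.pi * z.re) with ht
  have hcont := (Zc_analytic k z).continuousAt
  have ht1 : -1 ≤ t := Real.neg_one_le_cos _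
  by_cases h : t = -1
  · right
    have hne : Zc k z - q ≠ 0 := by
      rw [hZ]; norm_cast; intro h'; linarith
    have h1 : ContinuousAt (fun z => rt (g2 q k z)) z :=
      rt_cont.continuousAt.comp ((hcont.add continuousAt_const).div
        (hcont.sub continuousAt_const) hne)
    have h2 : rt (g2 q k z) = 0 := by
      rw [g2, hZ, h]; simp [rt]
    have := h1.tendsto
    rwa [h2] at this
  · left
    have ht2 : 0 < t + 1 := by
      have := lt_of_le_of_ne ht1 (Ne.symm h); linarith
    have hne : Zc k z + 1 ≠ 0 := by
      rw [hZ]; norm_cast; exact ht2.ne'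
    have h1 : ContinuousAt (fun z => rt (g1 q k z)) z :=
      rt_cont.continuousAt.comp ((hcont.sub continuousAt_const).div
        (hcont.add continuousAt_const) hne)
    have h2 : rt (g1 q k z) = 0 := by
      have : g1 q k z = (((t - q) / (t + 1) : ℝ) : ℂ) := by
        rw [g1, hZ]; push_cast; rfl
      rw [this]
      apply rt_zero
      apply div_nonpos_of_nonpos_of_nonneg <;> linarith
    have := h1.tendsto
    rwa [h2] at this

/-- positive symmetric superharmonic functions on the unfolded domain -/
structure Good (b : ℂ → ℝ) (K : ℝ) (m : ℕ) (a k : Fin m → ℝ) : Prop where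
  sup : LSub (fun z => - b z) (Om K m a k)
  pos : ∀ z ∈ Om K m a k, 0 < b z
  sym : ∀ c : ℝ, c = 0 ∨ c = 1 → ∀ z ∈ Om K m a k, b ((2 * c : ℂ) - (starRingEnd ℂ) z) = b z

lemma LSub.neg_min {u v : ℂ → ℝ} {U : Set ℂ} (hU : IsOpen U) (hu : LSub (fun z => - u z) U)
    (hv : LSub (fun z => - v z) U) : LSub (fun z => - min (u z) (v z)) U := by
  have := LSub.sup hU hu hv
  simpa only [max_neg_neg] using this

lemma Good.min {b c : ℂ → ℝ} {K : ℝ} {m : ℕ} {a k : Fin m → ℝ} (hb : Good b K m a k)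
    (hc : Good c K m a k) : Good (fun z => Min.min (b z) (c z)) K m a k where
  sup := LSub.neg_min (Om_open _ _ _ _) hb.sup hc.sup
  pos z hz := lt_min (hb.pos z hz) (hc.pos z hz)
  sym d hd z hz := by
    show Min.min _ _ = Min.min _ _
    rw [hb.sym d hd z hz, hc.sym d hd z hz]

lemma good_top (K : ℝ) (m : ℕ) (a k : Fin m → ℝ) : Good (fun z => K - z.im) K m a k where
  sup := by
    apply LSub.of_neg_harm
    intro z hz
    have h : AnalyticAt ℂ (fun z : ℂ => (K : ℂ) + I * z) z := by fun_prop
    have h1 := h.harmonicAt_re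
    simpa [sub_eq_add_neg] using h1
  pos z hz := by have := hz.2.1; linarith
  sym c hc z hz := by simp

lemma q_bounds {a : ℝ} (ha : 0 < a ∧ a < 1) :
    -1 < Real.cos (Real.pi * a) ∧ Real.cos (Real.pi * a) < 1 := by
  have hp := Real.pi_pos
  have h0 : Real.cos (Real.pi * a) < Real.cos (Real.pi * 0) :=
    (cos_lt_iff ha ⟨le_rfl, zero_le_one⟩).2 ha.1
  have h1 : ¬ Real.cos (Real.pi * a) < Real.cos (Real.pi * 1) := by
    rw [cos_lt_iff ha ⟨zero_le_one, le_rfl⟩]; linarith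
  have h2 : Real.cos (Real.pi * 1) < Real.cos (Real.pi * a) := by
    apply Real.strictAntiOn_cos
    · constructor <;> nlinarith
    · constructor <;> nlinarith
    · nlinarith
  simp at h0 h2
  exact ⟨h2, h0⟩

lemma good_g1 {K : ℝ} {m : ℕ} {a k : Fin m → ℝ} (ha : ∀ i, 0 < a i ∧ a i < 1) (i : Fin m) :
    Good (fun z => rt (g1 (Real.cos (Real.pi * a i)) (k i) z)) K m a k where
  sup := LSub.of_neg_harm fun z hz => rt_g1_harm (q_bounds (ha i)) (hz.2.2 i)
  pos z hz := rt_pos (g_slitPlane (q_bounds (ha i)) (hz.2.2 i)).1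
  sym c hc z hz := by
    show rt _ = rt _
    rw [g1_refl _ _ hc, rt_conj]

lemma good_g2 {K : ℝ} {m : ℕ} {a k : Fin m → ℝ} (ha : ∀ i, 0 < a i ∧ a i < 1) (i : Fin m) :
    Good (fun z => rt (g2 (Real.cos (Real.pi * a i)) (k i) z)) K m a k where
  sup := LSub.of_neg_harm fun z hz => rt_g2_harm (q_bounds (ha i)) (hz.2.2 i)
  pos z hz := rt_pos (g_slitPlane (q_bounds (ha i)) (hz.2.2 i)).2.1
  sym c hc z hz := by
    show rt _ = rt _
    rw [g2_refl _ _ hc, rt_conj]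

lemma exists_good {K : ℝ} {m : ℕ} {a k : Fin m → ℝ} (ha : ∀ i, 0 < a i ∧ a i < 1)
    (S : Finset (Fin m)) : ∃ b : ℂ → ℝ, Good b K m a k ∧ (∀ z, b z ≤ K - z.im) ∧
      ∀ i ∈ S, (∀ z, b z ≤ rt (g1 (Real.cos (Real.pi * a i)) (k i) z)) ∧
        (∀ z, b z ≤ rt (g2 (Real.cos (Real.pi * a i)) (k i) z)) := by
  induction S using Finset.induction_on with
  | empty => exact ⟨_, good_top K m a k, fun z => le_rfl, by simp⟩
  | insert i S hi ih =>
    obtain ⟨b, hb, h1, h2⟩ := ih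
    refine ⟨_, (hb.min (good_g1 ha i)).min (good_g2 ha i), fun z => ?_, fun j hj => ?_⟩
    · exact (min_le_left _ _).trans ((min_le_left _ _).trans (h1 z))
    · rcases Finset.mem_insert.1 hj with rfl | hj
      · exact ⟨fun z => (min_le_left _ _).trans (min_le_right _ _), fun z => min_le_right _ _⟩
      · exact ⟨fun z => (min_le_left _ _).trans ((min_le_left _ _).trans ((h2 j hj).1 z)),
          fun z => (min_le_left _ _).trans ((min_le_left _ _).trans ((h2 j hj).2 z))⟩

lemma barrier {K : ℝ} {m : ℕ} {a k : Fin m → ℝ} (ha : ∀ i, 0 < a i ∧ a i < 1) :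
    ∃ b : ℂ → ℝ, Good b K m a k ∧ ∀ ζ : ℂ, 0 < ζ.im → ζ.im ≤ K → ζ ∉ Om K m a k →
      Tendsto b (𝓝[Om K m a k] ζ) (𝓝 0) := by
  obtain ⟨b, hb, h1, h2⟩ := exists_good (K := K) (k := k) ha Finset.univ
  refine ⟨b, hb, fun ζ h3 h4 h5 => ?_⟩
  have key : ∀ f : ℂ → ℝ, (∀ z, b z ≤ f z) → Tendsto f (𝓝 ζ) (𝓝 0) →
      Tendsto b (𝓝[Om K m a k] ζ) (𝓝 0) := by
    intro f hf hlim
    refine tendsto_of_tendsto_of_tendsto_of_le_of_le' tendsto_const_nhds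
      (hlim.mono_left nhdsWithin_le_nhds) ?_ (Eventually.of_forall hf)
    filter_upwards [self_mem_nhdsWithin] with z hz using (hb.pos z hz).le
  rcases h4.eq_or_lt with h | h
  · refine key _ h1 ?_
    have : Continuous (fun z : ℂ => K - z.im) := by fun_prop
    have := this.tendsto ζ
    simpa [h] using this
  · have : ∃ i, ζ.im = k i ∧ Real.cos (Real.pi * ζ.re) ≤ Real.cos (Real.pi * a i) := by
      by_contra hcon
      push Not at hcon
      exact h5 ⟨h3, h, hcon⟩
    obtain ⟨i, hi1, hi2⟩ := this
    obtain ⟨e1, e2⟩ := h2 i (Finset.mem_univ i)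
    rcases rt_g_tendsto (q_bounds (ha i)) hi1 hi2 with h | h
    · exact key _ e1 h
    · exact key _ e2 h

lemma Good.line {b : ℂ → ℝ} {K : ℝ} {m : ℕ} {a k : Fin m → ℝ} (hb : Good b K m a k) {δ : ℝ}
    (hδ : ∀ z : ℂ, z.im = δ → z ∈ Om K m a k) : ∃ β > 0, ∀ z : ℂ, z.im = δ → β ≤ b z := by
  let g : ℝ → ℝ := fun x => b (x + δ * I)
  have hmem : ∀ x : ℝ, (x + δ * I : ℂ) ∈ Om K m a k := fun x => hδ _ (by simp)
  have hbc : ContinuousOn b (Om K m a k) :=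
    hb.sup.cont.neg.congr fun z _ => (neg_neg (b z)).symm
  have hg : Continuous g := hbc.comp_continuous (by fun_prop) hmem
  have hper : Function.Periodic g 2 := by
    intro x
    have h1 := hb.sym 0 (Or.inl rfl) _ (hmem x)
    have h2 := hb.sym 1 (Or.inr rfl) _ (hδ ((2 * (0 : ℝ) : ℂ) - (starRingEnd ℂ) (x + δ * I)) (by simp))
    simp only [g]
    rw [← h1, ← h2]
    congr 1
    apply Complex.ext <;> simp
    ring
  have hcomp := hper.compact_of_continuous two_ne_zero hg
  obtain ⟨y, ⟨x, rfl⟩, hmin⟩ := hcomp.exists_isLeast (range_nonempty g)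
  refine ⟨g x, hb.pos _ (hmem x), fun z hz => ?_⟩
  have : b z = g z.re := by
    simp only [g]; congr 1; apply Complex.ext <;> simp [hz]
  rw [this]
  exact hmin (mem_range_self _)

/-- Everything needed for the Perron construction. -/
structure Barr (K : ℝ) (m : ℕ) (a k : Fin m → ℝ) (w : ℂ) (v0 s : ℂ → ℝ) : Prop where
  hv0 : LSub (fun z => - v0 z) (Om K m a k)
  hs : LSub s (Om K m a k)
  hs0 : ∀ z ∈ Om K m a k, 0 ≤ s z
  hsv : ∀ z ∈ Om K m a k, s z ≤ v0 z
  hpos : ∃ z ∈ slitRect K m a k, 0 < s z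
  hsym : ∀ c : ℝ, c = 0 ∨ c = 1 → ∀ z ∈ Om K m a k, v0 ((2 * c : ℂ) - (starRingEnd ℂ) z) = v0 z
  hbd : ∀ ζ : ℂ, 0 ≤ ζ.re → ζ.re ≤ 1 → 0 ≤ ζ.im → ζ.im ≤ K → ζ ∉ Om K m a k → ζ ≠ w →
      Tendsto v0 (𝓝[Om K m a k] ζ) (𝓝 0)
  hpole : ∃ r > 0, ∃ C : ℝ, ∀ z ∈ slitRect K m a k ∩ ball w r,
      v0 z ≤ (1 / Real.pi) * |(1 / (z - w)).im| + C ∧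
      (1 / Real.pi) * |(1 / (z - w)).im| - C ≤ s z

theorem exists_barr {K : ℝ} (hK : 0 < K) {m : ℕ} {a k : Fin m → ℝ}
    (ha : ∀ i, 0 < a i ∧ a i < 1) (hk : ∀ i, 0 < k i ∧ k i < K) {x : ℝ} (hx : 0 < x ∧ x < 1) :
    ∃ v0 s, Barr K m a k x v0 s := by
  set U := Om K m a k with hUdef
  have hU : IsOpen U := Om_open K m a k
  obtain ⟨b, hb, hbz⟩ := barrier (K := K) (k := k) ha
  obtain ⟨δ, hδ0, hδK, hδk⟩ : ∃ δ : ℝ, 0 < δ ∧ δ < K ∧ ∀ i, δ < k i := by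
    have h1 : ∀ᶠ x in 𝓝[>] (0 : ℝ), ∀ i, x < k i := by
      rw [eventually_all]
      intro i
      filter_upwards [Ioo_mem_nhdsGT (hk i).1] with x hx using hx.2
    obtain ⟨α, h2, h3⟩ := (h1.and (Ioo_mem_nhdsGT hK)).exists
    exact ⟨α, h3.1, h3.2, h2⟩
  have hlow : ∀ z : ℂ, 0 < z.im → z.im ≤ δ → z ∈ U := fun z h1 h2 =>
    ⟨h1, by linarith, fun i hi => by linarith [hδk i]⟩
  obtain ⟨β, hβ, hβb⟩ := hb.line (δ := δ) (fun z hz => hlow z (by rw [hz]; exact hδ0) hz.le)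
  obtain ⟨C1, hC1⟩ := hk0_bdd x hδ0
  have hC1p : 0 < C1 := (hk0_pos x (z := (δ * I : ℂ)) (by simpa using hδ0)).trans_le
    (hC1 _ (by simp))
  set M := (C1 + 1) / β with hM
  have hMp : 0 < M := by positivity
  have hline : ∀ z : ℂ, z.im = δ → hk0 x z < M * b z := by
    intro z hz
    have h1 := hC1 z hz.ge
    have h2 := mul_le_mul_of_nonneg_left (hβb z hz) hMp.le
    have h3 : M * β = C1 + 1 := by rw [hM]; field_simp
    linarith
  let v0 : ℂ → ℝ := fun z => if z.im ≤ δ then hk0 x z else min (hk0 x z) (M * b z)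
  let s : ℂ → ℝ := fun z => max 0 (hk0 x z - C1)
  have hharm : InnerProductSpace.HarmonicOnNhd (hk0 x) U := fun z hz => hk0_harm x hz.1
  have hhs : LSub (fun z => - hk0 x z) U := LSub.of_neg_harm hharm
  have hbc : ContinuousOn b U := hb.sup.cont.neg.congr fun z _ => (neg_neg (b z)).symm
  have hmin : LSub (fun z => - min (hk0 x z) (M * b z)) U := by
    apply LSub.neg_min hU hhs
    have := hb.sup.const_mul hMp.le
    simpa using this
  have hv0h : ∀ z, v0 z ≤ hk0 x z := by
    intro z; simp only [v0]; split_ifs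
    · exact le_rfl
    · exact min_le_left _ _
  have hv0pos : ∀ z ∈ U, 0 < v0 z := by
    intro z hz; simp only [v0]; split_ifs
    · exact hk0_pos x hz.1
    · exact lt_min (hk0_pos x hz.1) (mul_pos hMp (hb.pos z hz))
  have hloc : ∀ z ∈ U, (hk0 x =ᶠ[𝓝 z] v0) ∨ ((fun z => min (hk0 x z) (M * b z)) =ᶠ[𝓝 z] v0) := by
    intro z hz
    rcases lt_trichotomy z.im δ with h | h | h
    · left
      have : ∀ᶠ y : ℂ in 𝓝 z, y.im < δ :=
        (Complex.continuous_im.tendsto z).eventually (eventually_lt_nhds h)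
      filter_upwards [this] with y hy
      simp [v0, hy.le]
    · left
      have h1 : ContinuousAt (hk0 x) z := hharm.continuousOn.continuousAt (hU.mem_nhds hz)
      have h2 : ContinuousAt (fun y => M * b y) z :=
        continuousAt_const.mul (hbc.continuousAt (hU.mem_nhds hz))
      filter_upwards [h1.eventually_lt h2 (hline z h)] with y hy
      simp [v0, min_eq_left hy.le]
    · right
      have : ∀ᶠ y : ℂ in 𝓝 z, δ < y.im :=
        (Complex.continuous_im.tendsto z).eventually (eventually_gt_nhds h)
      filter_upwards [this] with y hy
      simp [v0, not_le.2 hy]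
  have hneg : ∀ {u v : ℂ → ℝ} {z : ℂ}, u =ᶠ[𝓝 z] v → (fun z => - u z) =ᶠ[𝓝 z] (fun z => - v z) := by
    intro u v z h
    filter_upwards [h] with y hy
    rw [hy]
  have hv0L : LSub (fun z => - v0 z) U := by
    constructor
    · intro z hz
      apply ContinuousAt.continuousWithinAt
      rcases hloc z hz with h | h
      · exact (hhs.cont.continuousAt (hU.mem_nhds hz)).congr (hneg h)
      · exact (hmin.cont.continuousAt (hU.mem_nhds hz)).congr (hneg h)
    · intro z hz
      rcases hloc z hz with h | h
      · exact (hhs.sub z hz).congr (hneg h)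
      · exact (hmin.sub z hz).congr (hneg h)
  have hsL : LSub s U := by
    apply LSub.sup hU
    · exact LSub.of_harm (fun z _ => InnerProductSpace.harmonicAt_const 0)
    · apply LSub.of_harm
      intro z hz
      exact (hk0_harm x hz.1).sub (InnerProductSpace.harmonicAt_const C1)
  obtain ⟨r, hr, C, hC⟩ := hk0_pole hx
  refine ⟨v0, s, hv0L, hsL, fun z _ => le_max_left _ _, ?_, ?_, ?_, ?_, ?_⟩
  · intro z hz
    apply max_le (hv0pos z hz).le
    simp only [v0]; split_ifs with h
    · linarith
    · have h1 := hC1 z (not_le.1 h).le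
      have h2 := hk0_pos x hz.1
      have h3 := mul_pos hMp (hb.pos z hz)
      apply le_min <;> linarith
  · -- positivity close to the pole
    set T := |C| + C1 + 1 with hT
    have hTp : 0 < T := by positivity
    obtain ⟨η, h1, h2⟩ : ∃ η : ℝ, 0 < η ∧ η < min (min r δ) (1 / (Real.pi * T)) := by
      apply exists_between
      have := Real.pi_pos
      positivity
    have h3 : η < r := h2.trans_le ((min_le_left _ _).trans (min_le_left _ _))
    have h4 : η < δ := h2.trans_le ((min_le_left _ _).trans (min_le_right _ _))
    have h5 : η < 1 / (Real.pi * T) := h2.trans_le (min_le_right _ _)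
    refine ⟨x + η * I, ?_, ?_⟩
    · rw [slitRect_iff ha]
      exact ⟨hlow _ (by simpa using h1) (by simpa using h4.le), by simpa using hx.1,
        by simpa using hx.2⟩
    · apply lt_max_of_lt_right
      have h6 := hC (x + η * I) (by simpa using h1) (by simpa [abs_of_pos h1] using h3)
      have h7 : (1 / ((x : ℂ) + η * I - x)).im = - (1 / η) := by
        have : (1 / ((x : ℂ) + η * I - x)) = ((1 / η : ℝ) : ℂ) * (-I) := by
          have : (η : ℂ) ≠ 0 := by exact_mod_cast h1.ne'
          push_cast
          rw [add_sub_cancel_left, one_div, mul_inv, Complex.inv_I, one_div]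
        rw [this]; simp
      rw [h7, abs_neg, abs_of_pos (one_div_pos.2 h1)] at h6
      have h8 : T < 1 / Real.pi * (1 / η) := by
        have := Real.pi_pos
        rw [lt_div_iff₀ (by positivity)] at h5
        rw [one_div_mul_one_div_rev, lt_div_iff₀ (by positivity)]
        linarith
      have h9 := (abs_le.1 h6).1
      have h10 := le_abs_self C
      linarith
  · intro c hc z hz
    have him : ((2 * c : ℂ) - (starRingEnd ℂ) z).im = z.im := by simp
    simp only [v0, him, hk0_refl x hc, hb.sym c hc z hz]
  · intro ζ h1 h2 h3 h4 h5 h6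
    have hnn : ∀ᶠ z in 𝓝[U] ζ, 0 ≤ v0 z := by
      filter_upwards [self_mem_nhdsWithin] with z hz using (hv0pos z hz).le
    rcases h3.eq_or_lt with h | h
    · exact tendsto_of_tendsto_of_tendsto_of_le_of_le' tendsto_const_nhds
        ((hk0_tendsto hx h1 h2 h.symm h6).mono_left nhdsWithin_le_nhds) hnn
        (Eventually.of_forall hv0h)
    · have hlim := (hbz ζ h h4 h5).const_mul M
      rw [mul_zero] at hlim
      refine tendsto_of_tendsto_of_tendsto_of_le_of_le' tendsto_const_nhds hlim hnn ?_
      have hδζ : δ < ζ.im := by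
        by_contra hcon
        exact h5 (hlow ζ h (not_lt.1 hcon))
      have : ∀ᶠ y : ℂ in 𝓝 ζ, δ < y.im :=
        (Complex.continuous_im.tendsto ζ).eventually (eventually_gt_nhds hδζ)
      filter_upwards [nhdsWithin_le_nhds this] with y hy
      simp only [v0, if_neg (not_le.2 hy)]
      exact min_le_right _ _
  · refine ⟨r, hr, |C| + C1, fun z hz => ?_⟩
    have hzU := ((slitRect_iff ha z).1 hz.1).1
    have h1 := abs_le.1 (hC z hzU.1 hz.2)
    have h2 := le_abs_self C
    have h3 := hv0h z
    refine ⟨by linarith, ?_⟩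
    refine le_trans ?_ (le_max_right _ _)
    linarith

theorem Barr.flip {K : ℝ} {m : ℕ} {a k : Fin m → ℝ} (ha : ∀ i, 0 < a i ∧ a i < 1) {w : ℂ}
    {v0 s : ℂ → ℝ} (h : Barr K m a (fun i => K - k i) w v0 s) :
    ∃ v1 s1, Barr K m a k ((starRingEnd ℂ) w + K * I) v1 s1 := by
  let F : ℂ → ℂ := fun z => (starRingEnd ℂ) z + K * I
  have hFre : ∀ z, (F z).re = z.re := fun z => by simp [F]
  have hFim : ∀ z, (F z).im = K - z.im := fun z => by simp [F]; ring
  have hFF : ∀ z, F (F z) = z := fun z => by simp [F]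
  have hFe : ∀ z, F z = K * I + cexp ((0 : ℝ) * I) * (starRingEnd ℂ) z := fun z => by
    simp [F]; ring
  have hOm : ∀ z, F z ∈ Om K m a (fun i => K - k i) ↔ z ∈ Om K m a k := by
    intro z
    simp only [Om, mem_setOf_eq, hFre, hFim, sub_right_inj]
    constructor
    · rintro ⟨h1, h2, h3⟩; exact ⟨by linarith, by linarith, h3⟩
    · rintro ⟨h1, h2, h3⟩; exact ⟨by linarith, by linarith, h3⟩
  have hsl : ∀ z, F z ∈ slitRect K m a (fun i => K - k i) ↔ z ∈ slitRect K m a k := by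
    intro z
    rw [slitRect_iff ha, slitRect_iff ha, hOm, hFre]
  have hFc : Continuous F := by simp only [F]; fun_prop
  have hL : ∀ {u : ℂ → ℝ}, LSub u (Om K m a (fun i => K - k i)) →
      LSub (fun z => u (F z)) (Om K m a k) := by
    intro u hu
    have := hu.refl (V := Om K m a k) (K * I) 0 (fun z hz => by
      rw [← hFe]; exact (hOm z).2 hz)
    simpa only [← hFe] using this
  refine ⟨fun z => v0 (F z), fun z => s (F z), hL h.hv0, hL h.hs,
    fun z hz => h.hs0 _ ((hOm z).2 hz), fun z hz => h.hsv _ ((hOm z).2 hz), ?_, ?_, ?_, ?_⟩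
  · obtain ⟨z, hz, hp⟩ := h.hpos
    refine ⟨F z, (hsl _).1 ?_, ?_⟩
    · rwa [hFF]
    · simpa only [hFF] using hp
  · intro c hc z hz
    show v0 (F _) = v0 (F z)
    rw [← h.hsym c hc _ ((hOm z).2 hz)]
    congr 1
    apply Complex.ext <;> simp [F]
    ring
  · intro ζ h1 h2 h3 h4 h5 h6
    have h7 := h.hbd (F ζ) (by rwa [hFre]) (by rwa [hFre]) (by rw [hFim]; linarith)
      (by rw [hFim]; linarith) (fun h8 => h5 ((hOm ζ).1 h8)) (fun h8 => h6 (by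
        rw [← hFF ζ, h8]))
    refine h7.comp ?_
    refine tendsto_nhdsWithin_of_tendsto_nhds_of_eventually_within _
      ((hFc.tendsto ζ).mono_left nhdsWithin_le_nhds) ?_
    filter_upwards [self_mem_nhdsWithin] with z hz using (hOm z).2 hz
  · obtain ⟨r, hr, C, hC⟩ := h.hpole
    refine ⟨r, hr, C, fun z hz => ?_⟩
    have e1 : F z - w = (starRingEnd ℂ) (z - ((starRingEnd ℂ) w + K * I)) := by
      apply Complex.ext <;> simp [F]
      ring
    have h1 := hC (F z) ⟨(hsl z).2 hz.1, by
      rw [mem_ball, dist_eq_norm, e1, Complex.norm_conj, ← dist_eq_norm]; exact hz.2⟩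
    have e2 : |(1 / (F z - w)).im| = |(1 / (z - ((starRingEnd ℂ) w + K * I))).im| := by
      rw [e1, one_div, one_div, ← map_inv₀, Complex.conj_im, abs_neg]
    rw [e2] at h1
    exact h1

/-- Existence of the Poisson kernel of the slit rectangle with mixed boundary conditions,
pole at any point of the open bottom or top edge. -/
theorem slit_poisson_exists (K : ℝ) (hK : 0 < K) (m : ℕ) (a k : Fin m → ℝ)
    (ha : ∀ i, 0 < a i ∧ a i < 1) (hk : ∀ i, 0 < k i ∧ k i < K) (hmono : StrictMono k) :
    ∀ w ∈ botEdge ∪ topEdge K, ∃ P H : ℂ → ℝ, IsMixedPoissonKernel K m a k w P H := by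
  have main : ∀ w v0 s, Barr K m a k w v0 s → ∃ P H : ℂ → ℝ, IsMixedPoissonKernel K m a k w P H :=
    fun w v0 s h => kernel_of_barrier hK ha hk h.hv0 h.hs h.hs0 h.hsv h.hpos h.hsym h.hbd h.hpole
  rintro w (⟨h1, h2, h3⟩ | ⟨h1, h2, h3⟩)
  · have hw : w = (w.re : ℂ) := by apply Complex.ext <;> simp [h3]
    obtain ⟨v0, s, h⟩ := exists_barr hK ha hk ⟨h1, h2⟩
    rw [hw]
    exact main _ v0 s h
  · have hw : w = (starRingEnd ℂ) (w.re : ℂ) + K * I := by apply Complex.ext <;> simp [h3]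
    obtain ⟨v0, s, h⟩ := exists_barr (k := fun i => K - k i) hK ha
      (fun i => ⟨by linarith [(hk i).2], by linarith [(hk i).1]⟩) ⟨h1, h2⟩
    obtain ⟨v1, s1, h'⟩ := h.flip ha
    rw [hw]
    exact main _ v1 s1 h'
end
end

section
/- Fix K > 0, an integer m ≥ 0, real numbers 0 < a₁, …, aₘ < 1 and 0 < k₁ < ⋯ < kₘ < K, and let Sᵢ = [aᵢ,1] × {kᵢ} ⊂ ℂ. Let D = ((0,1) × (0,K)) ∖ ⋃ᵢ Sᵢ, B = (0,1) × {0}, T = (0,1) × {K}, Γ_D = B ∪ T ∪ ⋃ᵢ Sᵢ and Γ_N = ({0} × (0,K)) ∪ ({1} × ((0,K) ∖ {k₁,…,kₘ})). Fix w ∈ B ∪ T and let P : D → ℝ satisfy: harmonic and strictly positive on D; extending continuously to cl(D) ∖ {w}; extension vanishing on Γ_D ∖ {w}; inner normal derivative existing and equal to 0 at every point of Γ_N; and P(z) − (1/π)·|Im(1/(z − w))| bounded on D ∩ B(w,r) for some r > 0. Then for every u ∈ B ∪ T with u ≠ w, the inward normal derivative of P at u is strictly positive, in the sense that liminf_{ε→0⁺}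 P(u + iε)/ε > 0 if u ∈ B, and liminf_{ε→0⁺} P(u − iε)/ε > 0 if u ∈ T. -/
open Set Metric Filter Complex Topology

noncomputable section

/-- `f` is near `z` the real part of an analytic function. -/
def LocRe (f : ℂ → ℝ) (z : ℂ) : Prop :=
  ∃ F : ℂ → ℂ, AnalyticAt ℂ F z ∧ f =ᶠ[𝓝 z] fun y => (F y).re

lemma locRe_const_of_max {f : ℂ → ℝ} {z : ℂ} (h : LocRe f z) (hm : IsLocalMax f z) :
    ∀ᶠ y in 𝓝 z, f y = f z := by
  obtain ⟨F, hF, hf⟩ := h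
  have hd : ∀ᶠ y in 𝓝 z, DifferentiableAt ℂ (fun y => Complex.exp (F y)) y := by
    filter_upwards [hF.eventually_analyticAt] with y hy
    exact hy.differentiableAt.cexp
  have hz : f z = (F z).re := hf.self_of_nhds
  have hc : IsLocalMax (norm ∘ fun y => Complex.exp (F y)) z := by
    filter_upwards [hm, hf] with y h1 h2
    simp only [Function.comp, Complex.norm_exp]
    rw [Real.exp_le_exp, ← h2, ← hz]
    exact h1
  filter_upwards [Complex.norm_eventually_eq_of_isLocalMax hd hc, hf] with y h1 h2
  simp only [Complex.norm_exp] at h1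
  rw [h2, hz]
  exact Real.exp_injective h1

/-- Closed model rectangle. -/
def cRect (δ : ℝ) : Set ℂ := {z | -δ ≤ z.re ∧ z.re ≤ δ ∧ 0 ≤ z.im ∧ z.im ≤ δ}

lemma isCompact_cRect (δ : ℝ) : IsCompact (cRect δ) := by
  have : cRect δ = Icc (-δ) δ ×ℂ Icc 0 δ := by
    ext z; simp [cRect, Complex.mem_reProdIm, and_assoc]
  rw [this]
  exact isCompact_Icc.reProdIm isCompact_Icc

lemma weak_max {f : ℂ → ℝ} {δ : ℝ} (hc : ContinuousOn f (cRect δ))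
    (hl : ∀ z : ℂ, -δ < z.re → z.re < δ → 0 < z.im → z.im < δ → LocRe f z)
    (hb : ∀ z ∈ cRect δ, (z.re = -δ ∨ z.re = δ ∨ z.im = 0 ∨ z.im = δ) → f z ≤ 0) :
    ∀ z ∈ cRect δ, f z ≤ 0 := by
  intro z0 hz0
  obtain ⟨p, hp, hmax⟩ := (isCompact_cRect δ).exists_isMaxOn ⟨z0, hz0⟩ hc
  by_contra hpos
  push Not at hpos
  have hfp : 0 < f p := lt_of_lt_of_le hpos (hmax hz0)
  have hS : IsCompact (cRect δ ∩ f ⁻¹' {f p}) :=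
    (isCompact_cRect δ).of_isClosed_subset
      (hc.preimage_isClosed_of_isClosed (isCompact_cRect δ).isClosed isClosed_singleton)
      inter_subset_left
  obtain ⟨q, ⟨hq, hqf⟩, hqm⟩ := hS.exists_isMaxOn ⟨p, hp, rfl⟩ Complex.continuous_im.continuousOn
  have hqf : f q = f p := hqf
  obtain ⟨h1, h2, h3, h4⟩ := hq
  have hnb : ¬ (q.re = -δ ∨ q.re = δ ∨ q.im = 0 ∨ q.im = δ) := fun h => by
    have := hb q ⟨h1, h2, h3, h4⟩ h
    linarith
  push Not at hnb
  obtain ⟨n1, n2, n3, n4⟩ := hnb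
  have l1 := lt_of_le_of_ne h1 n1.symm
  have l2 := lt_of_le_of_ne h2 n2
  have l3 := lt_of_le_of_ne h3 n3.symm
  have l4 := lt_of_le_of_ne h4 n4
  have hnhds : ∀ᶠ y in 𝓝 q, y ∈ cRect δ := by
    have e1 : ∀ᶠ y : ℂ in 𝓝 q, -δ < y.re := Complex.continuous_re.continuousAt.eventually (lt_mem_nhds l1)
    have e2 : ∀ᶠ y : ℂ in 𝓝 q, y.re < δ := Complex.continuous_re.continuousAt.eventually (gt_mem_nhds l2)
    have e3 : ∀ᶠ y : ℂ in 𝓝 q, 0 < y.im := Complex.continuous_im.continuousAt.eventually (lt_mem_nhds l3)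
    have e4 : ∀ᶠ y : ℂ in 𝓝 q, y.im < δ := Complex.continuous_im.continuousAt.eventually (gt_mem_nhds l4)
    filter_upwards [e1, e2, e3, e4] with y a b c d using ⟨a.le, b.le, c.le, d.le⟩
  have hlm : IsLocalMax f q := by
    filter_upwards [hnhds] with y hy
    rw [hqf]; exact hmax hy
  have hev := (locRe_const_of_max (hl q l1 l2 l3 l4) hlm).and hnhds
  have ht : Tendsto (fun η : ℝ => q + (η : ℂ) * Complex.I) (𝓝[>] (0 : ℝ)) (𝓝 q) := by
    have : ContinuousAt (fun η : ℝ => q + (η : ℂ) * Complex.I) 0 := by fun_prop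
    have h := this.tendsto
    simp only [Complex.ofReal_zero, zero_mul, add_zero] at h
    exact h.mono_left nhdsWithin_le_nhds
  obtain ⟨η, ⟨hη1, hη2⟩, hη3⟩ := ((ht.eventually hev).and self_mem_nhdsWithin).exists
  have hη3 : 0 < η := hη3
  have hmem : q + (η : ℂ) * Complex.I ∈ cRect δ ∩ f ⁻¹' {f p} :=
    ⟨hη2, by rw [mem_preimage, hη1, hqf]; rfl⟩
  have := hqm hmem
  simp at this
  linarith

lemma LocRe.add_re {f g : ℂ → ℝ} {z : ℂ} (h : LocRe f z) {G : ℂ → ℂ} (hG : AnalyticAt ℂ G z)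
    (hg : ∀ y, g y = (G y).re) : LocRe (fun y => f y + g y) z := by
  obtain ⟨F, hF, hf⟩ := h
  refine ⟨fun y => F y + G y, hF.add hG, ?_⟩
  filter_upwards [hf] with y hy
  simp [hy, hg]

lemma LocRe.neg' {f : ℂ → ℝ} {z : ℂ} (h : LocRe f z) : LocRe (fun y => - f y) z := by
  obtain ⟨F, hF, hf⟩ := h
  refine ⟨fun y => - F y, hF.neg, ?_⟩
  filter_upwards [hf] with y hy
  simp [hy]

lemma core {Q : ℂ → ℝ} {δ : ℝ} (hδ : 0 < δ) (hc : ContinuousOn Q (cRect δ))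
    (hl : ∀ z : ℂ, -δ < z.re → z.re < δ → 0 < z.im → z.im < δ → LocRe Q z)
    (h0 : ∀ z ∈ cRect δ, z.im = 0 → Q z = 0)
    (hpos : ∀ z ∈ cRect δ, 0 < z.im → 0 < Q z) :
    ∃ c > 0, ∃ C : ℝ, ∀ ε : ℝ, 0 < ε → ε < δ →
      c * ε ≤ Q ((ε : ℂ) * Complex.I) ∧ Q ((ε : ℂ) * Complex.I) ≤ C * ε := by
  have hnn : ∀ z ∈ cRect δ, 0 ≤ Q z := fun z hz => by
    rcases hz.2.2.1.eq_or_lt with h | h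
    · exact (h0 z hz h.symm).ge
    · exact (hpos z hz h).le
  -- upper bound
  obtain ⟨p, hp, hmax⟩ := (isCompact_cRect δ).exists_isMaxOn
    ⟨0, by simp [cRect, hδ.le]⟩ hc
  -- top edge minimum
  have hT : IsCompact (cRect δ ∩ {z | z.im = δ}) :=
    (isCompact_cRect δ).inter_right (isClosed_eq Complex.continuous_im continuous_const)
  obtain ⟨q, ⟨hq, hqi⟩, hmin⟩ := hT.exists_isMinOn
    ⟨(δ : ℂ) * Complex.I, by simp [cRect, hδ.le]⟩ (hc.mono inter_subset_left)
  have hqi : q.im = δ := hqi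
  have hqp : 0 < Q q := hpos q hq (by rw [hqi]; exact hδ)
  set c : ℝ := Q q / (2 * δ ^ 3) with hcdef
  have hcpos : 0 < c := by positivity
  have hcq : c * (2 * δ ^ 3) = Q q := by rw [hcdef]; field_simp
  set A : ℝ := Q p / δ ^ 2 with hA
  have hA0 : 0 ≤ A := div_nonneg (hnn p hp) (by positivity)
  have hAp : A * δ ^ 2 = Q p := by rw [hA]; field_simp
  have low := weak_max (f := fun z => - Q z + c * (z.im * (δ ^ 2 + z.im ^ 2 - 3 * z.re ^ 2))) (δ := δ)
    (by
      apply hc.neg.add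
      exact Continuous.continuousOn (by fun_prop))
    (by
      intro z a1 a2 a3 a4
      refine (hl z a1 a2 a3 a4).neg'.add_re
        (G := fun z => (c : ℂ) * (-(δ : ℂ) ^ 2 * Complex.I * z + Complex.I * z ^ 3)) (by fun_prop) ?_
      intro y
      simp [pow_succ]
      left
      ring)
    (by
      rintro z hz hb
      have hQ := hnn z hz
      obtain ⟨b1, b2, b3, b4⟩ := id hz
      have hxx : z.im ^ 2 ≤ δ ^ 2 := by nlinarith
      rcases hb with h | h | h | h
      · have : z.im * (δ ^ 2 + z.im ^ 2 - 3 * z.re ^ 2) ≤ 0 :=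
          mul_nonpos_of_nonneg_of_nonpos b3 (by rw [h]; nlinarith)
        nlinarith
      · have : z.im * (δ ^ 2 + z.im ^ 2 - 3 * z.re ^ 2) ≤ 0 :=
          mul_nonpos_of_nonneg_of_nonpos b3 (by rw [h]; nlinarith)
        nlinarith
      · simp only [h]; simp [hQ]
      · have h1 : Q q ≤ Q z := hmin ⟨hz, h⟩
        have : z.im * (δ ^ 2 + z.im ^ 2 - 3 * z.re ^ 2) ≤ 2 * δ ^ 3 := by
          rw [h]; nlinarith [mul_nonneg hδ.le (sq_nonneg z.re)]
        have := mul_le_mul_of_nonneg_left this hcpos.le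
        linarith)
  have up := weak_max (f := fun z => Q z + - (A * (z.re ^ 2 - z.im ^ 2 + 2 * δ * z.im))) (δ := δ)
    (by
      apply hc.add
      exact Continuous.continuousOn (by fun_prop))
    (by
      intro z a1 a2 a3 a4
      refine (hl z a1 a2 a3 a4).add_re
        (G := fun z => -((A : ℂ) * (z ^ 2 - 2 * (δ : ℂ) * Complex.I * z))) (by fun_prop) ?_
      intro y
      simp [pow_succ])
    (by
      rintro z hz hb
      have h1 : Q z ≤ Q p := hmax hz
      obtain ⟨b1, b2, b3, b4⟩ := id hz
      have hy : 0 ≤ z.im * (2 * δ - z.im) := mul_nonneg b3 (by linarith)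
      have key : (z.im ≠ 0 ∨ z.re ^ 2 = δ ^ 2) → (z.im = δ ∨ z.re ^ 2 = δ ^ 2) →
          Q z + - (A * (z.re ^ 2 - z.im ^ 2 + 2 * δ * z.im)) ≤ 0 := by
        intro _ h
        have : δ ^ 2 ≤ z.re ^ 2 - z.im ^ 2 + 2 * δ * z.im := by
          rcases h with h | h
          · rw [h]; nlinarith [sq_nonneg z.re]
          · nlinarith
        have := mul_le_mul_of_nonneg_left this hA0
        linarith
      rcases hb with h | h | h | h
      · have : z.re ^ 2 = δ ^ 2 := by rw [h]; ring
        exact key (Or.inr this) (Or.inr this)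
      · have : z.re ^ 2 = δ ^ 2 := by rw [h]
        exact key (Or.inr this) (Or.inr this)
      · simp only [h0 z hz h, h]
        have := mul_nonneg hA0 (sq_nonneg z.re)
        nlinarith
      · exact key (Or.inl (by rw [h]; exact hδ.ne')) (Or.inl h))
  refine ⟨c * δ ^ 2, by positivity, A * (2 * δ), fun ε h1 h2 => ?_⟩
  have hmem : (ε : ℂ) * Complex.I ∈ cRect δ := by
    simp [cRect, hδ.le, h1.le, h2.le]
  have u1 := low _ hmem
  have u2 := up _ hmem
  simp at u1 u2
  constructor
  · have : 0 ≤ c * ε ^ 3 := by positivity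
    nlinarith
  · have : 0 ≤ A * ε ^ 2 := by positivity
    nlinarith

lemma liminf_pos_of_bounds {g : ℝ → ℝ} {δ c C : ℝ} (hδ : 0 < δ) (hc : 0 < c)
    (h : ∀ ε : ℝ, 0 < ε → ε < δ → c * ε ≤ g ε ∧ g ε ≤ C * ε) :
    0 < Filter.liminf (fun ε : ℝ => g ε / ε) (𝓝[>] (0 : ℝ)) := by
  have hev : ∀ᶠ ε : ℝ in 𝓝[>] (0 : ℝ), 0 < ε ∧ ε < δ := Ioo_mem_nhdsGT hδ
  refine lt_of_lt_of_le hc (le_liminf_of_le ?_ ?_)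
  · apply IsBoundedUnder.isCoboundedUnder_ge
    refine ⟨C, ?_⟩
    rw [eventually_map]
    filter_upwards [hev] with ε he
    rw [div_le_iff₀ he.1]
    exact (h ε he.1 he.2).2
  · filter_upwards [hev] with ε he
    rw [le_div_iff₀ he.1]
    exact (h ε he.1 he.2).1

lemma isOpen_slitRect (K : ℝ) (m : ℕ) (a k : Fin m → ℝ) : IsOpen (slitRect K m a k) := by
  apply IsOpen.sdiff
  · have : {z : ℂ | 0 < z.re ∧ z.re < 1 ∧ 0 < z.im ∧ z.im < K} = Ioo 0 1 ×ℂ Ioo 0 K := by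
      ext z; simp [Complex.mem_reProdIm, and_assoc]
    rw [this]
    exact isOpen_Ioo.reProdIm isOpen_Ioo
  · apply isClosed_iUnion_of_finite
    intro i
    have : slitSeg (a i) (k i) = Icc (a i) 1 ×ℂ {k i} := by
      ext z; simp [slitSeg, Complex.mem_reProdIm, and_assoc]
    rw [this]
    exact isClosed_Icc.reProdIm isClosed_singleton

lemma locRe_of_harmonic {P : ℂ → ℝ} {U : Set ℂ} (hU : IsOpen U) (h : IsHarmonicOn P U) {z : ℂ}
    (hz : z ∈ U) : LocRe P z := by
  obtain ⟨r, hr, hrU⟩ := Metric.isOpen_iff.1 hU z hz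
  have hh : InnerProductSpace.HarmonicOnNhd P (ball z r) := by
    intro y hy
    have hyU := hrU hy
    refine ⟨h.1.contDiffAt (hU.mem_nhds hyU), ?_⟩
    filter_upwards [hU.mem_nhds hyU] with x hx
    rw [InnerProductSpace.laplacian_eq_iteratedFDeriv_complexPlane]
    exact h.2 x hx
  obtain ⟨F, hF, hFe⟩ := hh.exists_analyticOnNhd_ball_re_eq
  refine ⟨F, hF z (mem_ball_self hr), ?_⟩
  filter_upwards [ball_mem_nhds z hr] with y hy
  exact (hFe hy).symm

/-- Common part: local analysis at an edge point, `σ = 1` for bottom, `σ = -1` for top. -/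
lemma edge_case (K : ℝ) (m : ℕ) (a k : Fin m → ℝ) (w : ℂ) (P H : ℂ → ℝ)
    (hP : IsMixedPoissonKernel K m a k w P H) (u : ℂ) (huw : u ≠ w) (σ : ℝ)
    (hσ : σ = 1 ∨ σ = -1) {δ : ℝ} (hδ : 0 < δ)
    (hin : ∀ z ∈ cRect δ, 0 < z.im → u + (σ : ℂ) * z ∈ slitRect K m a k)
    (hbot : ∀ z ∈ cRect δ, z.im = 0 → u + (σ : ℂ) * z ∈ gammaD K m a k)
    (hw : ∀ z ∈ cRect δ, u + (σ : ℂ) * z ≠ w) :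
    0 < Filter.liminf (fun ε : ℝ => P (u + (σ : ℂ) * ((ε : ℂ) * Complex.I)) / ε) (𝓝[>] (0 : ℝ)) := by
  obtain ⟨hharm, hpos, hcont, hHP, hzero, -, -⟩ := hP
  have hU := isOpen_slitRect K m a k
  have hcl : ∀ z ∈ cRect δ, u + (σ : ℂ) * z ∈ closure (slitRect K m a k) := by
    intro z hz
    rcases hz.2.2.1.eq_or_lt with h | h
    · have ht : Tendsto (fun η : ℝ => u + (σ : ℂ) * (z + (η : ℂ) * Complex.I)) (𝓝[>] (0 : ℝ))
          (𝓝 (u + (σ : ℂ) * z)) := by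
        have : ContinuousAt (fun η : ℝ => u + (σ : ℂ) * (z + (η : ℂ) * Complex.I)) 0 := by fun_prop
        have h := this.tendsto
        simp only [Complex.ofReal_zero, zero_mul, add_zero] at h
        exact h.mono_left nhdsWithin_le_nhds
      refine mem_closure_of_tendsto ht ?_
      have hev : ∀ᶠ ε : ℝ in 𝓝[>] (0 : ℝ), 0 < ε ∧ ε < δ := Ioo_mem_nhdsGT hδ
      filter_upwards [hev] with η hη
      apply hin
      · obtain ⟨h1, h2, h3, h4⟩ := hz
        refine ⟨by simpa using h1, by simpa using h2, ?_, ?_⟩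
        · simp [← h, hη.1.le]
        · simp [← h, hη.2.le]
      · simp [← h, hη.1]
    · exact subset_closure (hin z hz h)
  obtain ⟨c, hc, C, hC⟩ := core (Q := fun z => H (u + (σ : ℂ) * z)) hδ
    (by
      apply hcont.comp (Continuous.continuousOn (by fun_prop))
      intro z hz
      exact ⟨hcl z hz, hw z hz⟩)
    (by
      intro z h1 h2 h3 h4
      have hmem := hin z ⟨h1.le, h2.le, h3.le, h4.le⟩ h3
      obtain ⟨F, hF, hf⟩ := locRe_of_harmonic hU hharm hmem
      refine ⟨fun y => F (u + (σ : ℂ) * y), ?_, ?_⟩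
      · exact AnalyticAt.fun_comp (f := fun y => u + (σ : ℂ) * y) hF (by fun_prop)
      · have hct : Tendsto (fun y => u + (σ : ℂ) * y) (𝓝 z) (𝓝 (u + (σ : ℂ) * z)) := by
          have : Continuous (fun y => u + (σ : ℂ) * y) := by fun_prop
          exact this.tendsto z
        filter_upwards [hct.eventually hf, hct.eventually (hU.mem_nhds hmem)] with y e1 e2
        rw [hHP _ e2, e1])
    (by
      intro z hz h
      exact hzero _ ⟨hbot z hz h, hw z hz⟩)
    (by
      intro z hz h
      have := hin z hz h
      rw [hHP _ this]
      exact hpos _ this)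
  apply liminf_pos_of_bounds (C := C) hδ hc
  intro ε h1 h2
  have hm : u + (σ : ℂ) * ((ε : ℂ) * Complex.I) ∈ slitRect K m a k := by
    apply hin
    · simp [cRect, hδ.le, h1.le, h2.le]
    · simpa using h1
  have := hC ε h1 h2
  simp only [hHP _ hm] at this
  exact this

/-- Strict positivity of the inward normal derivative of the mixed Poisson kernel of the slit
rectangle at boundary points of the bottom/top edges different from the pole. -/
theorem slit_poisson_normal_deriv_pos (K : ℝ) (hK : 0 < K) (m : ℕ) (a k : Fin m → ℝ)
    (ha : ∀ i, 0 < a i ∧ a i < 1) (hk : ∀ i, 0 < k i ∧ k i < K) (hmono : StrictMono k)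
    (w : ℂ) (hw : w ∈ botEdge ∪ topEdge K) (P H : ℂ → ℝ)
    (hP : IsMixedPoissonKernel K m a k w P H)
    (u : ℂ) (hu : u ∈ botEdge ∪ topEdge K) (huw : u ≠ w) :
    (u ∈ botEdge →
      0 < Filter.liminf (fun ε : ℝ => P (u + (ε : ℂ) * Complex.I) / ε) (𝓝[>] (0 : ℝ))) ∧
    (u ∈ topEdge K →
      0 < Filter.liminf (fun ε : ℝ => P (u - (ε : ℂ) * Complex.I) / ε) (𝓝[>] (0 : ℝ))) := by
  have hre : 0 < u.re ∧ u.re < 1 := by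
    rcases hu with h | h <;> exact ⟨h.1, h.2.1⟩
  obtain ⟨δ, hδ, d1, d2, d3, d4, d5⟩ : ∃ δ : ℝ, 0 < δ ∧ δ < u.re ∧ δ < 1 - u.re ∧ δ < K ∧
      (∀ i, δ < k i ∧ δ < K - k i) ∧ δ < dist u w / 2 := by
    have e : ∀ x : ℝ, 0 < x → ∀ᶠ δ : ℝ in 𝓝[>] (0 : ℝ), δ < x := fun x hx =>
      nhdsWithin_le_nhds (gt_mem_nhds hx)
    have e4 : ∀ᶠ δ : ℝ in 𝓝[>] (0 : ℝ), ∀ i, δ < k i ∧ δ < K - k i :=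
      eventually_all.2 fun i => (e _ (hk i).1).and (e _ (by linarith [(hk i).2]))
    have e0 : ∀ᶠ δ : ℝ in 𝓝[>] (0 : ℝ), 0 < δ := self_mem_nhdsWithin
    exact (e0.and ((e _ hre.1).and ((e _ (by linarith [hre.2])).and ((e _ hK).and
      (e4.and (e _ (half_pos (dist_pos.2 huw)))))))).exists
  have hw' : ∀ σ : ℝ, (σ = 1 ∨ σ = -1) → ∀ z ∈ cRect δ, u + (σ : ℂ) * z ≠ w := by
    rintro σ hσ z ⟨h1, h2, h3, h4⟩ rfl
    have hz : ‖z‖ ≤ |z.re| + |z.im| := Complex.norm_le_abs_re_add_abs_im z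
    have h5 : |z.re| ≤ δ := abs_le.2 ⟨h1, h2⟩
    have h6 : |z.im| ≤ δ := abs_le.2 ⟨by linarith, h4⟩
    have : dist u (u + (σ : ℂ) * z) = ‖z‖ := by
      rcases hσ with rfl | rfl <;> simp
    linarith
  constructor
  · intro hb
    have hi : u.im = 0 := hb.2.2
    have := edge_case K m a k w P H hP u huw 1 (Or.inl rfl) hδ
      (by
        rintro z ⟨h1, h2, h3, h4⟩ h
        refine ⟨⟨?_, ?_, ?_, ?_⟩, ?_⟩
        · simp; linarith
        · simp; linarith
        · simp [hi]; linarith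
        · simp [hi]; linarith
        · simp only [mem_iUnion, not_exists]
          rintro i ⟨-, -, h7⟩
          simp [hi] at h7
          linarith [(d4 i).1])
      (by
        rintro z ⟨h1, h2, h3, h4⟩ h
        refine Or.inl (Or.inl ⟨?_, ?_, ?_⟩)
        · simp; linarith
        · simp; linarith
        · simp [hi, h])
      (hw' 1 (Or.inl rfl))
    simpa using this
  · intro hb
    have hi : u.im = K := hb.2.2
    have := edge_case K m a k w P H hP u huw (-1) (Or.inr rfl) hδ
      (by
        rintro z ⟨h1, h2, h3, h4⟩ h
        refine ⟨⟨?_, ?_, ?_, ?_⟩, ?_⟩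
        · simp; linarith
        · simp; linarith
        · simp [hi]; linarith
        · simp [hi]; linarith
        · simp only [mem_iUnion, not_exists]
          rintro i ⟨-, -, h7⟩
          simp [hi] at h7
          linarith [(d4 i).2])
      (by
        rintro z ⟨h1, h2, h3, h4⟩ h
        refine Or.inl (Or.inr ⟨?_, ?_, ?_⟩)
        · simp; linarith
        · simp; linarith
        · simp [hi, h])
      (hw' (-1) (Or.inr rfl))
    simpa [sub_eq_add_neg] using this
end
end
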